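/- arXiv:1910.00209 — 3 statements merged into one kernel-verified Lean document; each statement's English description precedes it below -/
import Mathlib

section
/- Let G be a finite 2-group and g ∈ G such that K := ℚ(g) is not a cyclotomic field (i.e. K ≠ ℚ(ζ_m) for every positive integer m). Let M := max{χ(1) : χ an irreducible complex character of G}. Then M · ℤ_K ⊆ 2 · ℤ[G]. -/
open CategoryTheory Module Pointwise
open scoped MatrixGroups

/-- The set of all values `χ(g)` of irreducible complex characters `χ` of `G`. -/
noncomputable def charValues (G : Type) [Group G] : Set ℂ :=
  {z : ℂ | ∃ V : FDRep ℂ G, Simple V ∧ ∃ g : G, V.character g = z}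

/-- `ℚ(G)`, the field of character values of `G`, as a subfield of `ℂ`. -/
noncomputable def charField (G : Type) [Group G] : Subfield ℂ :=
  Subfield.closure (charValues G)

/-- `ℤ[G]`, the subring of `ℂ` generated by the character values of `G`. -/
noncomputable def charRing (G : Type) [Group G] : Subring ℂ :=
  Subring.closure (charValues G)

/-- The ring of integers of a subfield `K` of `ℂ`, i.e. the elements of `K` integral
over `ℤ`, as a subring of `ℂ`. -/
noncomputable def ringOfIntIn (K : Subfield ℂ) : Subring ℂ :=
  (integralClosure ℤ ℂ).toSubring ⊓ K.toSubring

/-- The additive quotient group `ℤ_{ℚ(G)}/ℤ[G]`. -/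
noncomputable def charQuot (G : Type) [Group G] :=
  ↥((ringOfIntIn (charField G)).toAddSubgroup) ⧸
    ((charRing G).toAddSubgroup.addSubgroupOf (ringOfIntIn (charField G)).toAddSubgroup)

noncomputable instance (G : Type) [Group G] : AddCommGroup (charQuot G) := by
  unfold charQuot; infer_instance

/-- The `m`-th cyclotomic field `ℚ(ζ_m)`, as the subfield of `ℂ` generated by the
`m`-th roots of unity. -/
noncomputable def cycField (m : ℕ) : Subfield ℂ :=
  Subfield.closure {z : ℂ | z ^ m = 1}

/-- The set of values `χ(g)` at a fixed `g` of irreducible complex characters `χ` of `G`. -/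
noncomputable def charValuesAt {G : Type} [Group G] (g : G) : Set ℂ :=
  {z : ℂ | ∃ V : FDRep ℂ G, Simple V ∧ V.character g = z}

/-- `ℚ(g)`, the subfield of `ℂ` generated by one column of the character table. -/
noncomputable def charFieldAt {G : Type} [Group G] (g : G) : Subfield ℂ :=
  Subfield.closure (charValuesAt g)

/-- `ℤ[g]`, the subring of `ℂ` generated by one column of the character table. -/
noncomputable def charRingAt {G : Type} [Group G] (g : G) : Subring ℂ :=
  Subring.closure (charValuesAt g)



section Reps

variable {G : Type} [Group G]

/-- The additive monoid generated by the irreducible complex characters of `G`. -/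
noncomputable def charMonoid (G : Type) [Group G] : AddSubmonoid (G → ℂ) :=
  AddSubmonoid.closure {f : G → ℂ | ∃ V : FDRep ℂ G, Simple V ∧ V.character = f}

lemma character_of {V : Type} [AddCommGroup V] [Module ℂ V] [FiniteDimensional ℂ V]
    (ρ : Representation ℂ G V) : (FDRep.of ρ).character = ρ.character := rfl

lemma character_eq_ρ_character (V : FDRep ℂ G) :
    V.character = Representation.character (k := ℂ) (G := G) (V := V) V.ρ := rfl

lemma simple_of_isIrreducible [Finite G] {V : Type} [AddCommGroup V] [Module ℂ V]
    [FiniteDimensional ℂ V] (ρ : Representation ℂ G V) [ρ.IsIrreducible] :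
    Simple (FDRep.of ρ) := by
  have := Fintype.ofFinite G
  have hne : (Nat.card G : ℂ) ≠ 0 := by exact_mod_cast Nat.card_pos.ne'
  have := invertibleOfNonzero hne
  rw [FDRep.simple_iff_char_is_norm_one]
  have h := ρ.card_inv_mul_sum_char_mul_char_eq_finrank ρ
  rw [Representation.IsIrreducible.finrank_intertwiningMap_self] at h
  rw [character_of]
  field_simp at h
  simpa using h

/-- Schur's lemma: an endomorphism commuting with a simple representation is a scalar. -/
lemma exists_smul_of_commute [Finite G] (V : FDRep ℂ G) (hV : Simple V) (T : V →ₗ[ℂ] V)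
    (hT : ∀ h : G, T ∘ₗ V.ρ h = V.ρ h ∘ₗ T) : ∃ c : ℂ, T = c • LinearMap.id := by
  have := Fintype.ofFinite G
  have hne : (Nat.card G : ℂ) ≠ 0 := by exact_mod_cast Nat.card_pos.ne'
  have := invertibleOfNonzero hne
  rw [FDRep.simple_iff_char_is_norm_one, character_eq_ρ_character] at hV
  have h := Representation.card_inv_mul_sum_char_mul_char_eq_finrank (k := ℂ) (G := G)
    (V := V) (W := V) V.ρ V.ρ
  rw [hV, inv_mul_cancel₀ hne] at h
  have h1 : finrank ℂ (Representation.IntertwiningMap (A := ℂ) (G := G) (V := V) (W := V) V.ρ V.ρ) = 1 := by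
    exact_mod_cast h.symm
  by_cases hid : (LinearMap.id : V →ₗ[ℂ] V) = 0
  · refine ⟨0, ?_⟩
    ext x
    have : x = 0 := by simpa using LinearMap.congr_fun hid x
    simp [this]
  let I : Representation.IntertwiningMap (A := ℂ) (G := G) (V := V) (W := V) V.ρ V.ρ :=
    ⟨LinearMap.id, fun g => by rfl⟩
  let S : Representation.IntertwiningMap (A := ℂ) (G := G) (V := V) (W := V) V.ρ V.ρ :=
    ⟨T, fun g => hT g⟩
  have hI : I ≠ 0 := fun h0 => hid (congrArg Representation.IntertwiningMap.toLinearMap h0)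
  obtain ⟨c, hc⟩ := (finrank_eq_one_iff_of_nonzero' I hI).mp h1 S
  exact ⟨c, (congrArg Representation.IntertwiningMap.toLinearMap hc).symm⟩

lemma character_eq_add_of_isCompl {V : Type} [AddCommGroup V] [Module ℂ V]
    [FiniteDimensional ℂ V] (ρ : Representation ℂ G V) (S T : Subrepresentation ρ)
    (hST : IsCompl S.toSubmodule T.toSubmodule) :
    ρ.character = S.toRepresentation.character + T.toRepresentation.character := by
  ext h
  have := LinearMap.trace_conj' ((S.toRepresentation h).prodMap (T.toRepresentation h))
    (Submodule.prodEquivOfIsCompl _ _ hST)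
  rw [LinearMap.trace_prodMap'] at this
  rw [Pi.add_apply]
  refine Eq.trans ?_ this
  refine congrArg (LinearMap.trace ℂ V) ?_
  ext v
  obtain ⟨⟨a, b⟩, rfl⟩ := (Submodule.prodEquivOfIsCompl _ _ hST).surjective v
  rw [LinearEquiv.conj_apply_apply, LinearEquiv.symm_apply_apply]
  simp [Submodule.coe_prodEquivOfIsCompl', Subrepresentation.toRepresentation]

lemma character_mem_charMonoid [Finite G] {V : Type} [AddCommGroup V] [Module ℂ V]
    [FiniteDimensional ℂ V] (ρ : Representation ℂ G V) : ρ.character ∈ charMonoid G := by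
  have hne : NeZero (Nat.card G : ℂ) := ⟨by exact_mod_cast Nat.card_pos.ne'⟩
  induction hn : finrank ℂ V using Nat.strong_induction_on generalizing V with
  | _ n ih =>
  by_cases hirr : ρ.IsIrreducible
  · exact AddSubmonoid.subset_closure ⟨FDRep.of ρ, simple_of_isIrreducible ρ, rfl⟩
  by_cases hnt : Nontrivial (Subrepresentation ρ)
  · have : ∃ S : Subrepresentation ρ, S ≠ ⊥ ∧ S ≠ ⊤ := by
      by_contra! hcon
      exact hirr ⟨fun S => or_iff_not_imp_left.2 (hcon S)⟩
    obtain ⟨S, hb, ht⟩ := this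
    obtain ⟨T, hT⟩ := exists_isCompl S
    have hc : IsCompl S.toSubmodule T.toSubmodule := by
      constructor
      · rw [disjoint_iff, ← Subrepresentation.toSubmodule_inf, hT.inf_eq_bot]; rfl
      · rw [codisjoint_iff, ← Subrepresentation.toSubmodule_sup, hT.sup_eq_top]; rfl
    have hadd := Submodule.finrank_add_eq_of_isCompl hc
    have hS : S.toSubmodule ≠ ⊥ := fun h => hb (Subrepresentation.toSubmodule_injective h)
    have hS' : S.toSubmodule ≠ ⊤ := fun h => ht (Subrepresentation.toSubmodule_injective h)
    have h1 := Submodule.finrank_lt hS'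
    have h2 : 0 < finrank ℂ S.toSubmodule := by
      rwa [Nat.pos_iff_ne_zero, Ne, Submodule.finrank_eq_zero]
    rw [character_eq_add_of_isCompl ρ S T hc]
    exact add_mem (ih _ (by omega) S.toRepresentation rfl) (ih _ (by omega) T.toRepresentation rfl)
  · have : ρ.character = 0 := by
      rw [not_nontrivial_iff_subsingleton] at hnt
      have h0 : (⊥ : Subrepresentation ρ) = ⊤ := Subsingleton.elim _ _
      have h1 : ∀ v : V, v = 0 := fun v => by
        have : v ∈ (⊤ : Subrepresentation ρ) := Submodule.mem_top (R := ℂ) (x := v)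
        rw [← h0] at this
        exact (Submodule.mem_bot ℂ).1 this
      ext h
      have : ρ h = 0 := by ext v; rw [h1 (ρ h v)]; rfl
      change LinearMap.trace ℂ V (ρ h) = 0
      rw [this, map_zero]
    rw [this]
    exact zero_mem _

lemma trace_mem_charMonoid [Finite G] {V : Type} [AddCommGroup V] [Module ℂ V]
    [FiniteDimensional ℂ V] (ρ : Representation ℂ G V) (P : V →ₗ[ℂ] V) (hP : P ∘ₗ P = P)
    (hc : ∀ h, P ∘ₗ ρ h = ρ h ∘ₗ P) :
    (fun h => LinearMap.trace ℂ V (ρ h ∘ₗ P)) ∈ charMonoid G := by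
  let S : Subrepresentation ρ := ⟨LinearMap.range P, by
    rintro h _ ⟨w, rfl⟩
    exact ⟨ρ h w, LinearMap.congr_fun (hc h) w⟩⟩
  have := character_mem_charMonoid S.toRepresentation
  refine (congrArg (· ∈ charMonoid G) (funext fun h => ?_)).mpr this
  let P' : V →ₗ[ℂ] S.toSubmodule := P.rangeRestrict
  have h1 : S.toRepresentation h = (P' ∘ₗ ρ h) ∘ₗ S.toSubmodule.subtype := by
    ext ⟨_, w, rfl⟩
    have e1 := LinearMap.congr_fun (hc h) (P w)
    have e2 := LinearMap.congr_fun hP w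
    simp only [LinearMap.comp_apply] at e1 e2
    change ρ h (P w) = P (ρ h (P w))
    rw [e1, e2]
  change _ = LinearMap.trace ℂ _ (S.toRepresentation h)
  rw [h1, LinearMap.trace_comp_comm' S.toSubmodule.subtype (P' ∘ₗ ρ h)]
  refine congrArg _ (LinearMap.ext fun v => ?_)
  change ρ h (P v) = P (ρ h v)
  exact (LinearMap.congr_fun (hc h) v).symm

end Reps


section Projections

variable {V : Type*} [AddCommGroup V] [Module ℂ V] {N : ℕ} {ζ : ℂ}

/-- The projection onto the `ζ ^ c`-eigenspace of an operator `T` with `T ^ N = 1`. -/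
noncomputable def eigenProj (ζ : ℂ) (N : ℕ) (T : Module.End ℂ V) (c : ℕ) : Module.End ℂ V :=
  (N : ℂ)⁻¹ • ∑ i ∈ Finset.range N, (ζ⁻¹ ^ (c * i)) • T ^ i

lemma sum_inv_pow_mul_pow (hζ : IsPrimitiveRoot ζ N) {i : ℕ} (hi : i < N) :
    ∑ c ∈ Finset.range N, ζ⁻¹ ^ (c * i) = if i = 0 then (N : ℂ) else 0 := by
  simp_rw [mul_comm _ i, pow_mul]
  split_ifs with h
  · simp [h]
  · have h1 : ζ⁻¹ ^ i ≠ 1 := fun h' => by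
      have := hζ.inv.pow_ne_one_of_pos_of_lt h hi
      exact this h'
    have h2 := mul_neg_geom_sum (ζ⁻¹ ^ i) N
    rw [← pow_mul, mul_comm i N, pow_mul, hζ.inv.pow_eq_one, one_pow, sub_self, mul_eq_zero,
      sub_eq_zero] at h2
    exact h2.resolve_left fun h => h1 h.symm

lemma mul_eigenProj (hN : 0 < N) (hζ : IsPrimitiveRoot ζ N) {T : Module.End ℂ V} (hT : T ^ N = 1)
    (c : ℕ) : T * eigenProj ζ N T c = ζ ^ c • eigenProj ζ N T c := by
  have hζ0 : ζ ≠ 0 := hζ.ne_zero hN.ne'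
  rw [eigenProj, mul_smul_comm, smul_comm (ζ ^ c)]
  congr 1
  rw [Finset.mul_sum, Finset.smul_sum]
  have key : ∀ i, T * (ζ⁻¹ ^ (c * i) • T ^ i) =
      (fun i => ζ ^ c • (ζ⁻¹ ^ (c * i) • T ^ i)) (i + 1) := fun i => by
    rw [mul_smul_comm, ← pow_succ']
    beta_reduce
    rw [smul_smul]
    congr 1
    rw [mul_add, mul_one, pow_add, mul_left_comm, ← mul_pow, mul_inv_cancel₀ hζ0, one_pow, mul_one]
  simp_rw [key]
  have h1 := (Finset.sum_range_succ' (fun i => ζ ^ c • (ζ⁻¹ ^ (c * i) • T ^ i)) N).symm.trans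
    (Finset.sum_range_succ _ N)
  have h2 : ζ ^ c • (ζ⁻¹ ^ (c * N) • T ^ N) = ζ ^ c • (ζ⁻¹ ^ (c * 0) • T ^ 0) := by
    rw [hT, mul_comm c N, pow_mul, hζ.inv.pow_eq_one]
    simp
  rw [h2] at h1
  exact add_right_cancel h1

lemma pow_mul_eigenProj (hN : 0 < N) (hζ : IsPrimitiveRoot ζ N) {T : Module.End ℂ V}
    (hT : T ^ N = 1) (c b : ℕ) : T ^ b * eigenProj ζ N T c = ζ ^ (c * b) • eigenProj ζ N T c := by
  induction b with
  | zero => simp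
  | succ b ih =>
    rw [pow_succ', mul_assoc, ih, mul_smul_comm, mul_eigenProj hN hζ hT, smul_smul, mul_add,
      pow_add, mul_one]

lemma eigenProj_mul_self (hN : 0 < N) (hζ : IsPrimitiveRoot ζ N) {T : Module.End ℂ V}
    (hT : T ^ N = 1) (c : ℕ) :
    eigenProj ζ N T c * eigenProj ζ N T c = eigenProj ζ N T c := by
  have hζ0 : ζ ≠ 0 := hζ.ne_zero hN.ne'
  conv_lhs => enter [1]; rw [eigenProj]
  rw [smul_mul_assoc, Finset.sum_mul]
  simp_rw [smul_mul_assoc, pow_mul_eigenProj hN hζ hT, smul_smul, ← mul_pow, inv_mul_cancel₀ hζ0,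
    one_pow, one_smul]
  rw [Finset.sum_const, Finset.card_range, ← Nat.cast_smul_eq_nsmul ℂ, smul_smul,
    inv_mul_cancel₀ (by exact_mod_cast hN.ne'), one_smul]

lemma sum_eigenProj (hN : 0 < N) (hζ : IsPrimitiveRoot ζ N) (T : Module.End ℂ V) :
    ∑ c ∈ Finset.range N, eigenProj ζ N T c = 1 := by
  simp_rw [eigenProj]
  rw [← Finset.smul_sum, Finset.sum_comm]
  simp_rw [← Finset.sum_smul]
  rw [Finset.sum_congr rfl fun i hi => by
    rw [sum_inv_pow_mul_pow hζ (Finset.mem_range.1 hi)]]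
  simp_rw [ite_smul, zero_smul]
  rw [Finset.sum_ite_eq' (Finset.range N) 0, if_pos (Finset.mem_range.2 hN), pow_zero, smul_smul,
    inv_mul_cancel₀ (by exact_mod_cast hN.ne'), one_smul]

lemma pow_eq_sum_eigenProj (hN : 0 < N) (hζ : IsPrimitiveRoot ζ N) {T : Module.End ℂ V}
    (hT : T ^ N = 1) (b : ℕ) :
    T ^ b = ∑ c ∈ Finset.range N, ζ ^ (c * b) • eigenProj ζ N T c := by
  rw [← mul_one (T ^ b), ← sum_eigenProj hN hζ T, Finset.mul_sum]
  simp_rw [pow_mul_eigenProj hN hζ hT]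

lemma commute_eigenProj {T S : Module.End ℂ V} (h : Commute S T) (c : ℕ) :
    Commute S (eigenProj ζ N T c) :=
  (Commute.sum_right _ _ _ fun i _ => (h.pow_right i).smul_right _).smul_right _

/-- The eigenvalue multiplicities of an element of order dividing `N` in a representation. -/
lemma exists_multiplicity {G : Type} [Group G] (hN : 0 < N) (hζ : IsPrimitiveRoot ζ N)
    (V : FDRep ℂ G) (h : G) (hh : h ^ N = 1) :
    ∃ m : ℕ → ℕ, (∀ b : ℕ, V.character (h ^ b) = ∑ c ∈ Finset.range N, (m c : ℂ) * ζ ^ (c * b)) ∧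
      ∑ c ∈ Finset.range N, m c = finrank ℂ V := by
  let T : Module.End ℂ V := V.ρ h
  have hT : T ^ N = 1 := by
    change (V.ρ h) ^ N = 1
    rw [← map_pow, hh, map_one]
  have htr : ∀ c, LinearMap.trace ℂ V (eigenProj ζ N T c) =
      (finrank ℂ (LinearMap.range (eigenProj ζ N T c)) : ℂ) := fun c =>
    LinearMap.IsProj.trace (LinearMap.IsIdempotentElem.isProj_range _ (eigenProj_mul_self hN hζ hT c))
  have key : ∀ b : ℕ, V.character (h ^ b) = ∑ c ∈ Finset.range N,
      (finrank ℂ (LinearMap.range (eigenProj ζ N T c)) : ℂ) * ζ ^ (c * b) := fun b => by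
    have : V.character (h ^ b) = LinearMap.trace ℂ V (T ^ b) := by
      change LinearMap.trace ℂ V (V.ρ (h ^ b)) = LinearMap.trace ℂ V ((V.ρ h) ^ b)
      rw [map_pow]
    rw [this, pow_eq_sum_eigenProj hN hζ hT, map_sum]
    simp_rw [map_smul, htr, smul_eq_mul, mul_comm]
  refine ⟨fun c => finrank ℂ (LinearMap.range (eigenProj ζ N T c)), key, ?_⟩
  have := key 0
  rw [pow_zero, FDRep.char_one] at this
  simp only [mul_zero, pow_zero, mul_one] at this
  exact_mod_cast this.symm

end Projections

section Induced

variable {G : Type} [Group G]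

/-- The left regular representation on functions. -/
def leftReg (G : Type) [Group G] : Representation ℂ G (G → ℂ) where
  toFun h := LinearMap.funLeft ℂ ℂ fun t => h⁻¹ * t
  map_one' := by ext f t; simp [LinearMap.funLeft]
  map_mul' a b := by ext f t; simp [LinearMap.funLeft, mul_assoc]

/-- Right translation on functions. -/
def rightTrans (g : G) : Module.End ℂ (G → ℂ) := LinearMap.funLeft ℂ ℂ fun t => t * g

lemma rightTrans_pow_apply (g : G) (i : ℕ) (f : G → ℂ) (t : G) :
    (rightTrans g ^ i) f t = f (t * g ^ i) := by
  induction i generalizing f t with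
  | zero => simp
  | succ i ih =>
    rw [pow_succ, Module.End.mul_apply, ih]
    simp [rightTrans, LinearMap.funLeft, pow_succ, mul_assoc]

lemma trace_funLeft {G : Type*} [Finite G] (σ : G → G) :
    LinearMap.trace ℂ (G → ℂ) (LinearMap.funLeft ℂ ℂ σ) = (Nat.card {t : G // σ t = t} : ℂ) := by
  classical
  have := Fintype.ofFinite G
  rw [LinearMap.trace_eq_matrix_trace ℂ (Pi.basisFun ℂ G), Matrix.trace]
  simp only [Matrix.diag_apply, LinearMap.toMatrix_apply, Pi.basisFun_apply, Pi.basisFun_repr,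
    LinearMap.funLeft_apply, Pi.single_apply]
  rw [Finset.sum_boole, Nat.card_eq_fintype_card, Fintype.card_subtype]

lemma trace_leftReg_mul_rightTrans_pow [Finite G] (g h : G) (i : ℕ) :
    LinearMap.trace ℂ (G → ℂ) (leftReg G h * rightTrans g ^ i) =
      (Nat.card {t : G // t⁻¹ * h * t = g ^ i} : ℂ) := by
  have : leftReg G h * rightTrans g ^ i = LinearMap.funLeft ℂ ℂ fun t => h⁻¹ * t * g ^ i := by
    ext1 f
    ext t
    rw [Module.End.mul_apply]
    change (rightTrans g ^ i) f (h⁻¹ * t) = _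
    rw [rightTrans_pow_apply]
    rfl
  rw [this, trace_funLeft]
  congr 1
  refine Nat.card_congr (Equiv.subtypeEquivRight fun t => ?_)
  constructor
  · intro ht
    rw [mul_assoc, ← ht]
    nth_rw 2 [← ht]
    group
  · intro ht
    rw [← ht]
    group

/-- The characters of `G` induced from the characters of a cyclic subgroup. -/
lemma exists_induced [Finite G] {N : ℕ} {ζ : ℂ} (hN : 0 < N) (hζ : IsPrimitiveRoot ζ N) (g : G)
    (hg : g ^ N = 1) :
    ∃ f : ℕ → G → ℂ, (∀ c, f c ∈ charMonoid G) ∧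
      (∀ c h, N * f c h =
        ∑ i ∈ Finset.range N, ζ⁻¹ ^ (c * i) * (Nat.card {t : G // t⁻¹ * h * t = g ^ i} : ℂ)) ∧
      (∀ h, (Nat.card {t : G // t⁻¹ * h * t = g} : ℂ) = ∑ c ∈ Finset.range N, ζ ^ c * f c h) := by
  have hT : (rightTrans g) ^ N = 1 := by
    ext1 f
    ext t
    rw [rightTrans_pow_apply, hg, mul_one]
    rfl
  have hcomm : ∀ h, Commute (leftReg G h) (rightTrans g) := fun h => by
    ext1 f
    ext t
    simp [leftReg, rightTrans, LinearMap.funLeft, mul_assoc]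
  refine ⟨fun c h => LinearMap.trace ℂ (G → ℂ) (leftReg G h * eigenProj ζ N (rightTrans g) c),
    fun c => ?_, fun c h => ?_, fun h => ?_⟩
  · exact trace_mem_charMonoid (leftReg G) _ (eigenProj_mul_self hN hζ hT c) fun h =>
      ((commute_eigenProj (hcomm h) c).eq).symm
  · change (N : ℂ) * LinearMap.trace ℂ (G → ℂ) (leftReg G h * eigenProj ζ N (rightTrans g) c) = _
    rw [eigenProj, mul_smul_comm, map_smul, smul_eq_mul, ← mul_assoc,
      mul_inv_cancel₀ (by exact_mod_cast hN.ne'), one_mul, Finset.mul_sum, map_sum]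
    simp_rw [mul_smul_comm, map_smul, trace_leftReg_mul_rightTrans_pow, smul_eq_mul]
  · have h1 := trace_leftReg_mul_rightTrans_pow g h 1
    rw [pow_one g] at h1
    rw [← h1, pow_eq_sum_eigenProj hN hζ hT, Finset.mul_sum, map_sum]
    simp_rw [mul_smul_comm, map_smul, smul_eq_mul, mul_one]

/-- Irreducible characters separate conjugacy classes. -/
lemma isConj_of_character_eq [Finite G] (g h : G)
    (H : ∀ V : FDRep ℂ G, Simple V → V.character g = V.character h) : IsConj g h := by
  have hN : 0 < Nat.card G := Nat.card_pos
  obtain ⟨f, hf, -, hf2⟩ := exists_induced hN (Complex.isPrimitiveRoot_exp _ hN.ne') g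
    pow_card_eq_one'
  have key : ∀ u ∈ charMonoid G, u g = u h := fun u hu => by
    induction hu using AddSubmonoid.closure_induction with
    | mem x hx => obtain ⟨V, hV, rfl⟩ := hx; exact H V hV
    | zero => rfl
    | add x y _ _ hx hy => simp [hx, hy]
  have h1 : (Nat.card {t : G // t⁻¹ * g * t = g} : ℂ) = Nat.card {t : G // t⁻¹ * h * t = g} := by
    rw [hf2, hf2]
    exact Finset.sum_congr rfl fun c _ => by rw [key _ (hf c)]
  have h2 : Nat.card {t : G // t⁻¹ * g * t = g} = Nat.card {t : G // t⁻¹ * h * t = g} := by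
    exact_mod_cast h1
  have : Nonempty {t : G // t⁻¹ * g * t = g} := ⟨⟨1, by simp⟩⟩
  have h3 : 0 < Nat.card {t : G // t⁻¹ * h * t = g} := h2 ▸ Nat.card_pos
  obtain ⟨⟨t, ht⟩⟩ := (Nat.card_pos_iff.1 h3).1
  rw [isConj_iff]
  exact ⟨t, by rw [← ht]; group⟩

end Induced


section Degrees

variable {G : Type} [Group G]

lemma isIntegral_character [Finite G] (V : FDRep ℂ G) (g : G) : IsIntegral ℤ (V.character g) := by
  have hN : 0 < Nat.card G := Nat.card_pos
  have hζ := Complex.isPrimitiveRoot_exp _ hN.ne'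
  obtain ⟨m, hm, -⟩ := exists_multiplicity hN hζ V g pow_card_eq_one'
  have := hm 1
  rw [pow_one] at this
  rw [this]
  refine IsIntegral.sum _ fun c _ => IsIntegral.mul ?_ ((hζ.isIntegral hN).pow _)
  exact_mod_cast isIntegral_algebraMap (R := ℤ) (A := ℂ) (x := (m c : ℤ))

/-- Degrees of irreducible complex representations divide the group order. -/
lemma finrank_dvd_card [Finite G] (V : FDRep ℂ G) (hV : Simple V) :
    finrank ℂ V ∣ Nat.card G := by
  have := Fintype.ofFinite G
  let R := integralClosure ℤ ℂ
  let E : V →ₗ[ℂ] V := ∑ g : G, V.character g⁻¹ • V.ρ g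
  have hE : ∀ h : G, E ∘ₗ V.ρ h = V.ρ h ∘ₗ E := fun h => by
    change E * V.ρ h = V.ρ h * E
    rw [Finset.sum_mul, Finset.mul_sum]
    refine Fintype.sum_equiv (MulAut.conj h⁻¹).toEquiv _ _ fun g => ?_
    have h1 : V.character (h⁻¹ * g * h)⁻¹ = V.character g⁻¹ := by
      rw [← V.char_conj g⁻¹ h⁻¹]
      congr 1
      group
    simp only [MulEquiv.toEquiv_eq_coe, EquivLike.coe_coe, MulAut.conj_apply, inv_inv, h1]
    rw [smul_mul_assoc, mul_smul_comm, ← map_mul, ← map_mul]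
    congr 2
    group
  obtain ⟨s, hs⟩ := exists_smul_of_commute V hV E hE
  have htr : s * finrank ℂ V = Nat.card G := by
    rw [← (FDRep.simple_iff_char_is_norm_one V).1 hV]
    have h1 : LinearMap.trace ℂ V E = s * finrank ℂ V := by
      rw [hs, map_smul, LinearMap.trace_id, smul_eq_mul]
    rw [← h1]
    change LinearMap.trace ℂ V (∑ g : G, V.character g⁻¹ • V.ρ g) = _
    rw [map_sum]
    refine Finset.sum_congr rfl fun g _ => ?_
    rw [map_smul, smul_eq_mul, mul_comm]
    rfl
  have hd : finrank ℂ V ≠ 0 := fun h0 => by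
    rw [h0, Nat.cast_zero, mul_zero] at htr
    exact Nat.card_pos.ne (by exact_mod_cast htr)
  have hint : IsIntegral ℤ s := by
    let φ : MonoidAlgebra R G →ₐ[R] Module.End ℂ V := MonoidAlgebra.lift R (Module.End ℂ V) G V.ρ
    let x : MonoidAlgebra R G :=
      ∑ g : G, MonoidAlgebra.single g (⟨V.character g⁻¹, isIntegral_character V g⁻¹⟩ : R)
    have hφ : φ x = algebraMap ℂ (Module.End ℂ V) s := by
      have : φ x = E := by
        rw [map_sum]
        refine Finset.sum_congr rfl fun g _ => ?_
        rw [MonoidAlgebra.lift_single]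
        rfl
      rw [this, hs]
      rfl
    have hx : IsIntegral R (φ x) := (IsIntegral.of_finite R x).map φ
    rw [hφ] at hx
    have : Nontrivial V := Module.nontrivial_of_finrank_pos (R := ℂ) (Nat.pos_of_ne_zero hd)
    have hs' : IsIntegral R s :=
      (isIntegral_algebraMap_iff (FaithfulSMul.algebraMap_injective ℂ (Module.End ℂ V))).1 hx
    exact isIntegral_trans s hs'
  have hq : s = ((Nat.card G / finrank ℂ V : ℚ) : ℂ) := by
    push_cast
    rw [eq_div_iff (by exact_mod_cast hd), htr]
  have hint' : IsIntegral ℤ (Nat.card G / finrank ℂ V : ℚ) := by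
    rw [hq] at hint
    exact (isIntegral_algebraMap_iff (A := ℚ) (B := ℂ)
      (FaithfulSMul.algebraMap_injective ℚ ℂ)).1 hint
  obtain ⟨z, hz⟩ := IsIntegrallyClosed.isIntegral_iff.1 hint'
  have hz' : (Nat.card G : ℚ) = finrank ℂ V * z := by
    rw [show (z : ℚ) = Nat.card G / finrank ℂ V from hz]
    field_simp
  have : (finrank ℂ V : ℤ) ∣ (Nat.card G : ℤ) := ⟨z, by exact_mod_cast hz'⟩
  exact_mod_cast this

/-- The set of degrees of irreducible complex representations. -/
def degreeSet (G : Type) [Group G] : Set ℕ :=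
  {d : ℕ | ∃ V : FDRep ℂ G, Simple V ∧ finrank ℂ V = d}

lemma bddAbove_degreeSet [Finite G] : BddAbove (degreeSet G) := by
  refine ⟨Nat.card G, ?_⟩
  rintro _ ⟨V, hV, rfl⟩
  exact Nat.le_of_dvd Nat.card_pos (finrank_dvd_card V hV)

lemma sSup_degreeSet_eq_two_pow [Finite G] (hG : IsPGroup 2 G) (hne : (degreeSet G).Nonempty) :
    ∃ m : ℕ, sSup (degreeSet G) = 2 ^ m := by
  obtain ⟨V, hV, hd⟩ := Nat.sSup_mem hne bddAbove_degreeSet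
  obtain ⟨n, hn⟩ := IsPGroup.iff_card.1 hG
  have := finrank_dvd_card V hV
  rw [hn, hd] at this
  obtain ⟨m, -, hm⟩ := (Nat.dvd_prime_pow Nat.prime_two).1 this
  exact ⟨m, hm⟩

/-- A central involution acts as `1` or `-1` in an irreducible representation. -/
lemma character_mul_central_involution [Finite G] (V : FDRep ℂ G) (hV : Simple V) (z : G)
    (hz : z ∈ Subgroup.center G) (hz2 : z ^ 2 = 1) :
    ∃ s : ℂ, (s = 1 ∨ s = -1) ∧ ∀ g, V.character (g * z) = s * V.character g := by
  obtain ⟨s, hs⟩ := exists_smul_of_commute V hV (V.ρ z) fun h => by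
    change V.ρ z * V.ρ h = V.ρ h * V.ρ z
    rw [← map_mul, ← map_mul, Subgroup.mem_center_iff.1 hz h]
  have key : ∀ g, V.character (g * z) = s * V.character g := fun g => by
    change LinearMap.trace ℂ V (V.ρ (g * z)) = s * LinearMap.trace ℂ V (V.ρ g)
    rw [map_mul, hs]
    change LinearMap.trace ℂ V (V.ρ g * (s • 1)) = _
    rw [mul_smul_comm, map_smul, mul_one, smul_eq_mul]
  refine ⟨s, ?_, key⟩
  have h1 := key (1 * z)
  rw [mul_assoc, ← pow_two, hz2, key, one_mul, FDRep.char_one] at h1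
  have hd : (finrank ℂ V : ℂ) ≠ 0 := fun h0 => by
    have := finrank_dvd_card V hV
    rw [Nat.cast_eq_zero] at h0
    rw [h0, zero_dvd_iff] at this
    exact Nat.card_pos.ne' this
  have h2 : s * s = 1 := by
    have : (finrank ℂ V : ℂ) * (s * s - 1) = 0 := by linear_combination -h1
    linear_combination (mul_eq_zero.1 this).resolve_left hd
  exact mul_self_eq_one_iff.1 h2

/-- Irreducible characters of a quotient group inflate to irreducible characters. -/
lemma exists_inflation [Finite G] (Z : Subgroup G) [Z.Normal] (V : FDRep ℂ (G ⧸ Z))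
    (hV : Simple V) : ∃ W : FDRep ℂ G, Simple W ∧ ∀ g : G, W.character g = V.character (g : G ⧸ Z) := by
  classical
  have := Fintype.ofFinite G
  have := Fintype.ofFinite (G ⧸ Z)
  let ρ : Representation ℂ (G ⧸ Z) V := V.ρ
  let W : FDRep ℂ G := FDRep.of (V := V) (MonoidHom.comp ρ (QuotientGroup.mk' Z))
  have hW : ∀ g : G, W.character g = V.character (g : G ⧸ Z) := fun g => rfl
  refine ⟨W, ?_, hW⟩
  rw [FDRep.simple_iff_char_is_norm_one] at hV ⊢
  simp_rw [hW]
  have h1 := Finset.sum_fiberwise' (s := (Finset.univ : Finset G)) (g := fun g : G => (g : G ⧸ Z))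
    (f := fun x => V.character x * V.character x⁻¹)
  have h2 : ∀ x : G ⧸ Z, ((Finset.univ : Finset G).filter fun g : G => (g : G ⧸ Z) = x).card =
      Nat.card Z := fun x => by
    rw [← Fintype.card_subtype, ← Nat.card_eq_fintype_card]
    obtain ⟨y, rfl⟩ := QuotientGroup.mk_surjective x
    refine Nat.card_congr (((Equiv.mulLeft y).subtypeEquiv (p := (· ∈ Z)) fun a => ?_).symm)
    rw [eq_comm, QuotientGroup.eq]
    simp
  simp_rw [Finset.sum_const, h2] at h1
  rw [← Finset.smul_sum, hV] at h1
  change ∑ g : G, V.character (g : G ⧸ Z) * V.character (g : G ⧸ Z)⁻¹ = _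
  rw [← h1, nsmul_eq_mul, Subgroup.card_eq_card_quotient_mul_card_subgroup Z]
  push_cast
  ring

/-- In a finite `2`-group, non-conjugate elements are separated by an irreducible character with
opposite nonzero values. -/
lemma exists_character_eq_neg (n : ℕ) : ∀ (G : Type) [Group G] [Finite G], Nat.card G = n →
    IsPGroup 2 G → ∀ g h : G, ¬ IsConj g h →
    ∃ V : FDRep ℂ G, Simple V ∧ V.character h = -V.character g ∧ V.character g ≠ 0 := by
  induction n using Nat.strong_induction_on with
  | _ n ih =>
  intro G _ _ hn hG g h hgh
  have : Nontrivial G := ⟨g, h, fun e => hgh (e ▸ IsConj.refl _)⟩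
  have : Fact (Nat.Prime 2) := ⟨Nat.prime_two⟩
  have hnt : Nontrivial (Subgroup.center G) := hG.center_nontrivial
  obtain ⟨z, hz⟩ : ∃ z : Subgroup.center G, orderOf z = 2 := by
    refine exists_prime_orderOf_dvd_card' 2 ?_
    obtain ⟨k, hk, hk'⟩ := (hG.to_subgroup _).nontrivial_iff_card.1 hnt
    rw [hk']
    exact dvd_pow_self 2 hk.ne'
  obtain ⟨z, hzc⟩ := z
  rw [Subgroup.orderOf_mk] at hz
  have hz2 : z ^ 2 = 1 := hz ▸ pow_orderOf_eq_one z
  let Z := Subgroup.zpowers z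
  have hZn : Z.Normal := ⟨fun a ha c => by
    have : a ∈ Subgroup.center G := (Subgroup.zpowers_le.2 hzc) ha
    rw [Subgroup.mem_center_iff.1 this c, mul_assoc, mul_inv_cancel, mul_one]
    exact ha⟩
  by_cases hc : IsConj (g : G ⧸ Z) (h : G ⧸ Z)
  · have hgz : IsConj h (g * z) := by
      obtain ⟨c, hc⟩ := isConj_iff.1 hc
      obtain ⟨c, rfl⟩ := QuotientGroup.mk_surjective c
      rw [← QuotientGroup.mk_mul, ← QuotientGroup.mk_inv, ← QuotientGroup.mk_mul,
        QuotientGroup.eq] at hc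
      obtain ⟨i, hi⟩ := Subgroup.mem_zpowers_iff.1 hc
      have hcent := Subgroup.mem_center_iff.1 hzc
      rcases Int.even_or_odd' i with ⟨j, rfl | rfl⟩
      · rw [zpow_mul, zpow_ofNat, hz2, one_zpow, eq_comm, inv_mul_eq_one] at hi
        exact absurd (isConj_iff.2 ⟨c, hi⟩) hgh
      · rw [zpow_add, zpow_mul, zpow_ofNat, hz2, one_zpow, one_mul, zpow_one, eq_inv_mul_iff_mul_eq] at hi
        rw [isConj_comm, isConj_iff]
        refine ⟨c, ?_⟩
        rw [← hi, mul_assoc, mul_assoc, mul_assoc, mul_assoc, ← hcent c⁻¹]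
    by_contra! hcon
    have hsep : ¬ IsConj g (g * z) := fun h' => hgh (h'.trans hgz.symm)
    refine hsep (isConj_of_character_eq g (g * z) fun V hV => ?_)
    obtain ⟨s, hs, hs'⟩ := character_mul_central_involution V hV z hzc hz2
    have e : V.character h = V.character (g * z) := by
      obtain ⟨c, hc⟩ := isConj_iff.1 hgz
      rw [← hc, FDRep.char_conj]
    rcases hs with rfl | rfl
    · rw [hs', one_mul]
    · rw [hs' g, neg_one_mul] at e
      rw [hs' g, hcon V hV e]
      simp
  · have hlt : Nat.card (G ⧸ Z) < n := by
      have h1 := Subgroup.card_eq_card_quotient_mul_card_subgroup Z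
      have h2 : Nat.card Z = 2 := by rw [Nat.card_zpowers, hz]
      have h3 : 0 < Nat.card (G ⧸ Z) := Nat.card_pos
      rw [h2] at h1
      omega
    obtain ⟨V, hV, h1, h2⟩ := ih _ hlt (G ⧸ Z) rfl (hG.to_quotient Z) g h hc
    obtain ⟨W, hW, hW'⟩ := exists_inflation Z V hV
    exact ⟨W, hW, by rw [hW', hW', h1], by rwa [hW']⟩

end Degrees


section TwoAdic

open Polynomial

lemma exists_one_sub_X_pow (w : ℕ) :
    ∃ h : ℤ[X], (1 - X) ^ 2 ^ w = X ^ 2 ^ w + 1 + 2 * h := by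
  induction w with
  | zero => exact ⟨-X, by ring⟩
  | succ w ih =>
    obtain ⟨h, hh⟩ := ih
    refine ⟨X ^ 2 ^ w + 2 * h * (X ^ 2 ^ w + 1) + 2 * h ^ 2, ?_⟩
    rw [pow_succ, pow_mul, hh, pow_mul]
    ring

/-- Integer polynomials modulo an ideal containing `X ^ 2 ^ w + 1` and a power of two: a member
of the ideal of degree less than `2 ^ w` is divisible by `2 ^ s`, or the ideal contains `2 ^ s`. -/
lemma dvd_coeff_or_two_pow_mem {w n : ℕ} (J : Ideal ℤ[X]) (hX : X ^ 2 ^ w + 1 ∈ J)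
    (h2 : (2 : ℤ[X]) ^ n ∈ J) {p : ℤ[X]} (hp : p ∈ J) (hdeg : p.natDegree < 2 ^ w) (s : ℕ) :
    (∀ i, (2 : ℤ) ^ s ∣ p.coeff i) ∨ (2 : ℤ[X]) ^ s ∈ J := by
  let φ := Ideal.Quotient.mk J
  have hφ : ∀ f, φ f = 0 ↔ f ∈ J := fun f => Ideal.Quotient.eq_zero_iff_mem
  have h2n : IsNilpotent (φ 2) := ⟨n, by rw [← map_pow, hφ]; exact h2⟩
  obtain ⟨h, hh⟩ := exists_one_sub_X_pow w
  have hpi : φ (1 - X) ^ 2 ^ w = φ 2 * φ h := by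
    rw [← map_pow, hh, map_add, (hφ _).2 hX, zero_add, map_mul]
  have hpin : IsNilpotent (φ (1 - X)) := by
    have : IsNilpotent (φ (1 - X) ^ 2 ^ w) := by
      rw [hpi]
      exact (Commute.all _ _).isNilpotent_mul_right h2n
    exact this.of_pow
  have hunit : ∀ f : ℤ[X], Odd (f.eval 1) → IsUnit (φ f) := fun f hf => by
    obtain ⟨l, hl⟩ := hf
    obtain ⟨k, hk⟩ := X_sub_C_dvd_sub_C_eval (a := (1 : ℤ)) (p := f)
    have : f = 1 + (2 * C l + (1 - X) * -k) := by
      rw [hl] at hk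
      simp only [map_add, map_mul, map_one, map_ofNat] at hk
      linear_combination hk
    rw [this, map_add, map_one]
    refine IsNilpotent.isUnit_one_add ?_
    rw [map_add, map_mul, map_mul]
    exact (Commute.all _ _).isNilpotent_add ((Commute.all _ _).isNilpotent_mul_right h2n)
      ((Commute.all _ _).isNilpotent_mul_right hpin)
  have hu : IsUnit (φ h) := hunit h <| by
    have := congrArg (eval 1) hh
    simp only [eval_pow, eval_sub, eval_one, eval_X, sub_self, eval_add, one_pow, eval_mul,
      eval_ofNat] at this
    rw [zero_pow (by positivity)] at this
    exact ⟨-1, by linarith⟩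
  obtain ⟨v, hv⟩ := hu.exists_right_inv
  have h2v : φ 2 = φ (1 - X) ^ 2 ^ w * v := by rw [hpi, mul_assoc, hv, mul_one]
  by_cases hp0 : ∀ i, (2 : ℤ) ^ s ∣ p.coeff i
  · exact Or.inl hp0
  right
  have hpne : p ≠ 0 := fun h0 => hp0 fun i => by simp [h0]
  -- extract the exact power of two dividing `p`
  obtain ⟨t, hts, p', hpp', hp'⟩ : ∃ t < s, ∃ p' : ℤ[X], p = 2 ^ t * p' ∧ ¬ (2 : ℤ[X]) ∣ p' := by
    have hC : ∀ (t : ℕ) (f : ℤ[X]), (2 : ℤ[X]) ^ t ∣ f ↔ ∀ i, (2 : ℤ) ^ t ∣ f.coeff i := fun t f => by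
      rw [← C_dvd_iff_dvd_coeff, map_pow, map_ofNat]
    rw [← hC] at hp0
    have hex : ∃ t, ¬ (2 : ℤ[X]) ^ t ∣ p := ⟨s, hp0⟩
    classical
    have hspec := Nat.find_spec hex
    have hle : Nat.find hex ≤ s := Nat.find_min' hex hp0
    have hpos : Nat.find hex ≠ 0 := fun h0 => by rw [h0] at hspec; simp at hspec
    obtain ⟨t, ht⟩ := Nat.exists_eq_succ_of_ne_zero hpos
    have hdvd : (2 : ℤ[X]) ^ t ∣ p := by
      have := Nat.find_min hex (m := t) (by omega)
      rwa [not_not] at this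
    obtain ⟨p', rfl⟩ := hdvd
    refine ⟨t, by omega, p', rfl, fun hd => hspec ?_⟩
    rw [ht, Nat.succ_eq_add_one, pow_succ]
    exact mul_dvd_mul_left _ hd
  have hdeg' : p'.natDegree < 2 ^ w := by
    have : p.natDegree = p'.natDegree := by
      rw [hpp', show (2 : ℤ[X]) ^ t = C (2 ^ t) by simp, natDegree_C_mul (by positivity)]
    omega
  -- factor `p'` modulo two
  obtain ⟨r, hr, f, k, hf, hpf⟩ : ∃ r < 2 ^ w, ∃ f k : ℤ[X], Odd (f.eval 1) ∧
      p' = (1 - X) ^ r * f + 2 * k := by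
    let ψ := mapRingHom (Int.castRingHom (ZMod 2))
    have hψ : Function.Surjective ψ := map_surjective _ (ZMod.ringHom_surjective _)
    have hker : ∀ f : ℤ[X], ψ f = 0 → (2 : ℤ[X]) ∣ f := fun f hf => by
      rw [show (2 : ℤ[X]) = C 2 by simp, C_dvd_iff_dvd_coeff]
      intro i
      have := congrArg (fun g => coeff g i) hf
      simp only [ψ, coe_mapRingHom, coeff_map, coeff_zero] at this
      exact (ZMod.intCast_zmod_eq_zero_iff_dvd _ 2).1 this
    have hne : ψ p' ≠ 0 := fun h0 => hp' (hker _ h0)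
    obtain ⟨g, hg, hg'⟩ := exists_eq_pow_rootMultiplicity_mul_and_not_dvd (ψ p') hne 1
    obtain ⟨f, rfl⟩ := hψ g
    have hX1 : ψ (1 - X) = X - C 1 := by
      simp only [ψ, coe_mapRingHom, Polynomial.map_sub, Polynomial.map_one, map_X, map_one]
      have : (2 : (ZMod 2)[X]) = 0 := CharTwo.two_eq_zero
      linear_combination (1 - X) * this
    obtain ⟨k, hk⟩ := hker (p' - (1 - X) ^ rootMultiplicity 1 (ψ p') * f) (by
      rw [map_sub, map_mul, map_pow, hX1, ← hg, sub_self])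
    refine ⟨_, ?_, f, k, ?_, by rw [← hk]; ring⟩
    · have h1 := natDegree_le_of_dvd (pow_rootMultiplicity_dvd (ψ p') 1) hne
      rw [natDegree_pow, natDegree_X_sub_C, mul_one] at h1
      exact lt_of_le_of_lt (h1.trans natDegree_map_le) hdeg'

    · rw [dvd_iff_isRoot, IsRoot] at hg'
      have : eval 1 (ψ f) = ((eval 1 f : ℤ) : ZMod 2) := by
        simp only [ψ, coe_mapRingHom]
        simp
      rw [this] at hg'
      rw [← Int.not_even_iff_odd, even_iff_two_dvd]
      exact fun hd => hg' ((ZMod.intCast_zmod_eq_zero_iff_dvd _ 2).2 hd)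
  have hunit' : IsUnit (φ f + φ (1 - X) ^ (2 ^ w - r) * (v * φ k)) := by
    refine IsNilpotent.isUnit_add_left_of_commute ?_ (hunit f hf) (Commute.all _ _)
    refine (Commute.all _ _).isNilpotent_mul_right ?_
    exact hpin.pow_of_pos (by omega)
  have hzero : φ 2 ^ t * φ (1 - X) ^ r = 0 := by
    have h0 := (hφ p).2 hp
    have : φ p = φ 2 ^ t * φ (1 - X) ^ r * (φ f + φ (1 - X) ^ (2 ^ w - r) * (v * φ k)) := by
      rw [hpp', hpf, map_mul, map_pow, map_add, map_mul, map_mul, map_pow, h2v]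
      have : φ (1 - X) ^ 2 ^ w = φ (1 - X) ^ r * φ (1 - X) ^ (2 ^ w - r) := by
        rw [← pow_add, Nat.add_sub_cancel' hr.le]
      rw [← h2v]
      conv_lhs => enter [2, 2, 1]; rw [h2v, this]
      ring
    rw [this] at h0
    exact (hunit'.mul_left_eq_zero).1 h0
  have hzero' : φ 2 ^ (t + 1) = 0 := by
    rw [pow_succ]
    conv_lhs => enter [2]; rw [h2v, ← Nat.add_sub_cancel' hr.le, pow_add]
    rw [← mul_assoc, ← mul_assoc, hzero, zero_mul, zero_mul]
  rw [← hφ, map_pow, ← Nat.add_sub_cancel' (show t + 1 ≤ s from hts), pow_add, hzero', zero_mul]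

end TwoAdic


section Arithmetic

lemma exists_sq_pow_eq {r : ℕ} (hr : 2 ≤ r) (u : ℤ) (t : ℕ) :
    ∃ v : ℤ, (1 + 2 ^ r * (2 * u + 1)) ^ 2 ^ t = 1 + 2 ^ (r + t) * (2 * v + 1) := by
  induction t with
  | zero => exact ⟨u, by simp⟩
  | succ t ih =>
    obtain ⟨v, hv⟩ := ih
    refine ⟨v + 2 ^ (r + t - 2) * (2 * v + 1) ^ 2, ?_⟩
    rw [pow_succ 2 t, pow_mul, hv]
    obtain ⟨k, hk⟩ := Nat.exists_eq_add_of_le (show 2 ≤ r + t by omega)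
    rw [← add_assoc, hk, Nat.add_sub_cancel_left]
    ring

/-- Elements congruent to one modulo `2 ^ r` are modulo `2 ^ e` powers of any element which is
exactly congruent to `1 + 2 ^ r`. -/
lemma exists_pow_modEq {c b r : ℕ} (hr : 2 ≤ r) (hc : c % 2 ^ (r + 1) = 1 + 2 ^ r)
    (hb : b % 2 ^ r = 1) (e : ℕ) : ∃ s : ℕ, c ^ s ≡ b [MOD 2 ^ e] := by
  obtain ⟨u, hu⟩ : ∃ u : ℤ, (c : ℤ) = 1 + 2 ^ r * (2 * u + 1) := by
    refine ⟨(c / 2 ^ (r + 1) : ℕ), ?_⟩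
    have := Nat.div_add_mod c (2 ^ (r + 1))
    rw [hc] at this
    zify at this
    rw [← this]
    push_cast
    ring
  obtain ⟨v, hv⟩ : ∃ v : ℤ, (b : ℤ) = 1 + 2 ^ r * v := by
    refine ⟨(b / 2 ^ r : ℕ), ?_⟩
    have := Nat.div_add_mod b (2 ^ r)
    rw [hb] at this
    zify at this
    rw [← this]
    push_cast
    ring
  suffices H : ∀ f : ℕ, ∃ s : ℕ, (2 : ℤ) ^ (r + f) ∣ b - (c : ℤ) ^ s by
    obtain ⟨s, hs⟩ := H e
    refine ⟨s, (Nat.modEq_iff_dvd).2 ?_⟩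
    push_cast
    exact (pow_dvd_pow 2 (by omega)).trans hs
  intro f
  induction f with
  | zero => exact ⟨0, v, by rw [hv, pow_zero, add_zero]; ring⟩
  | succ f ih =>
    obtain ⟨s, w, hw⟩ := ih
    rcases Int.even_or_odd' w with ⟨k, rfl | rfl⟩
    · exact ⟨s, k, by rw [hw]; ring⟩
    · obtain ⟨x, hx⟩ := exists_sq_pow_eq hr u f
      rw [← hu] at hx
      have hodd : Odd ((c : ℤ) ^ s) := by
        refine Odd.pow ?_
        obtain ⟨r', rfl⟩ := Nat.exists_eq_succ_of_ne_zero (show r ≠ 0 by omega)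
        exact ⟨2 ^ r' * (2 * u + 1), by rw [hu, Nat.succ_eq_add_one]; ring⟩
      obtain ⟨y, hy⟩ := hodd
      refine ⟨s + 2 ^ f, k - y - x - 2 * y * x, ?_⟩
      rw [pow_add, hx, mul_add, ← sub_sub, mul_one, hw, hy, ← add_assoc, pow_succ]
      ring

lemma exists_five_pow_modEq {b : ℕ} (hb : b % 4 = 1) (e : ℕ) : ∃ s : ℕ, 5 ^ s ≡ b [MOD 2 ^ e] :=
  exists_pow_modEq (r := 2) le_rfl (by norm_num) (by simpa using hb) e

lemma five_pow_two_pow_modEq (t : ℕ) : 5 ^ 2 ^ t ≡ 1 + 2 ^ (t + 2) [MOD 2 ^ (t + 3)] := by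
  obtain ⟨v, hv⟩ := exists_sq_pow_eq (r := 2) le_rfl 0 t
  refine (Nat.modEq_iff_dvd.2 ?_).symm
  push_cast
  norm_num at hv
  rw [hv]
  exact ⟨v, by ring⟩

end Arithmetic

section Coordinates

lemma sum_range_two_mul_reflect {M : Type*} [AddCommMonoid M] (f : ℕ → M) {h : ℕ} (hh : 0 < h) :
    ∑ i ∈ Finset.range (2 * h), f i =
      f 0 + f h + ∑ i ∈ Finset.Ico 1 h, (f i + f (2 * h - i)) := by
  have h1 : ∑ i ∈ Finset.Ico (h + 1) (2 * h), f i = ∑ i ∈ Finset.Ico 1 h, f (2 * h - i) := by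
    have := Finset.sum_Ico_reflect f 1 (m := h) (n := 2 * h) (by omega)
    rw [this]
    congr 2
    omega
  rw [Finset.range_eq_Ico, Finset.sum_eq_sum_Ico_succ_bot (by omega),
    ← Finset.sum_Ico_consecutive f (n := h) (by omega) (by omega),
    Finset.sum_eq_sum_Ico_succ_bot (show h < 2 * h by omega), h1, Finset.sum_add_distrib]
  rw [zero_add]
  abel

variable {F : Type*} [Field F] {ω : F} {h : ℕ}

/-- Coordinates of an element fixed by an automorphism inverting `ω` up to sign. -/
lemma coords_of_fixed (hh : 0 < h) (he : Even h) (hω : ω ^ (2 * h) = -1)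
    (hli : ∀ c : ℕ → ℤ, ∑ i ∈ Finset.range (2 * h), (c i : F) * ω ^ i = 0 →
      ∀ i < 2 * h, c i = 0)
    (α : F →+* F) {ε : ℤ} (hε : ε = 1 ∨ ε = -1) (hα : α ω * ω = ε) (c : ℕ → ℤ)
    (hc : α (∑ i ∈ Finset.range (2 * h), (c i : F) * ω ^ i) =
      ∑ i ∈ Finset.range (2 * h), (c i : F) * ω ^ i) :
    (∀ i, 0 < i → i < 2 * h → |c (2 * h - i)| = |c i|) ∧
    ∑ i ∈ Finset.range (2 * h), (c i : F) * ω ^ i =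
      c 0 + ∑ i ∈ Finset.Ico 1 h, (c i : F) * (ω ^ i + α (ω ^ i)) := by
  have hω0 : ω ≠ 0 := by
    rintro rfl
    rw [zero_pow (by omega)] at hω
    exact one_ne_zero (α := F) (by linear_combination hω)
  have hp : ∀ i ≤ 2 * h, α (ω ^ i) = -((ε : F) ^ i * ω ^ (2 * h - i)) := fun i hi => by
    have h1 : α (ω ^ i) * ω ^ i = ε ^ i := by rw [map_pow, ← mul_pow, hα]
    have h2 : ω ^ (2 * h - i) * ω ^ i = -1 := by rw [← pow_add, Nat.sub_add_cancel hi, hω]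
    refine mul_right_cancel₀ (pow_ne_zero i hω0) ?_
    rw [h1, neg_mul, mul_assoc, h2]
    ring
  have hε2 : ∀ i ≤ 2 * h, ε ^ (2 * h - i) = ε ^ i := fun i hi => by
    rcases hε with rfl | rfl
    · simp
    · rcases Nat.even_or_odd i with h1 | h1
      · have : Even (2 * h - i) := by rw [Nat.even_sub hi]; simp [h1]
        rw [h1.neg_one_pow, this.neg_one_pow]
      · have : Odd (2 * h - i) := by
          rw [Nat.odd_sub hi]
          have h2 : ¬ Odd (2 * h) := by simp
          have h3 : ¬ Even i := Nat.not_even_iff_odd.2 h1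
          tauto
        rw [h1.neg_one_pow, this.neg_one_pow]
  have hc2 : ∀ i, 0 < i → i < 2 * h → c i = -(ε ^ i * c (2 * h - i)) := by
    have h0 := hli (fun i => if i = 0 then 0 else c i + ε ^ i * c (2 * h - i)) ?_
    · intro i hi hi'
      have := h0 i hi'
      simp only [hi.ne', if_false] at this
      linarith
    have h1 : α (∑ i ∈ Finset.range (2 * h), (c i : F) * ω ^ i) =
        c 0 + ∑ i ∈ Finset.Ico 1 (2 * h), -((ε : F) ^ i * c (2 * h - i) * ω ^ i) := by
      rw [Finset.range_eq_Ico, Finset.sum_eq_sum_Ico_succ_bot (by omega), map_add, map_sum]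
      congr 1
      · simp
      have h2 := Finset.sum_Ico_reflect (fun i => -((ε : F) ^ i * c (2 * h - i) * ω ^ i)) 1
        (m := 2 * h) (n := 2 * h) (by omega)
      rw [show 2 * h + 1 - 2 * h = 1 by omega, show 2 * h + 1 - 1 = 2 * h by omega] at h2
      rw [← h2]
      refine Finset.sum_congr rfl fun i hi => ?_
      have hi' : i ≤ 2 * h := (Finset.mem_Ico.1 hi).2.le
      have h3 : (ε : F) ^ (2 * h - i) = (ε : F) ^ i := by exact_mod_cast congrArg (Int.cast (R := F)) (hε2 i hi')
      rw [map_mul, map_intCast, hp i hi', h3, Nat.sub_sub_self hi']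
      ring
    rw [h1, Finset.range_eq_Ico, Finset.sum_eq_sum_Ico_succ_bot (show 0 < 2 * h by omega)
      (fun i => (c i : F) * ω ^ i)] at hc
    rw [Finset.range_eq_Ico, Finset.sum_eq_sum_Ico_succ_bot (by omega)]
    simp only [if_true, Int.cast_zero, zero_mul, zero_add]
    rw [pow_zero, mul_one, zero_add, add_right_inj] at hc
    rw [Finset.sum_congr rfl fun i hi => by
      rw [if_neg (show i ≠ 0 by have := (Finset.mem_Ico.1 hi).1; omega)]]
    push_cast
    simp_rw [add_mul]
    rw [Finset.sum_add_distrib, ← hc, Finset.sum_neg_distrib]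
    ring
  have habs : ∀ i, 0 < i → i < 2 * h → |c (2 * h - i)| = |c i| := fun i hi hi' => by
    rw [hc2 i hi hi', abs_neg, abs_mul]
    rcases hε with rfl | rfl <;> simp
  refine ⟨habs, ?_⟩
  have hch : c h = 0 := by
    have := hc2 h hh (by omega)
    rw [show 2 * h - h = h by omega] at this
    have h1 : ε ^ h = 1 := by rcases hε with rfl | rfl <;> simp [he.neg_one_pow]
    rw [h1] at this
    linarith
  rw [sum_range_two_mul_reflect _ hh, hch]
  simp only [pow_zero, mul_one, Int.cast_zero, zero_mul, add_zero]
  congr 1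
  refine Finset.sum_congr rfl fun i hi => ?_
  obtain ⟨hi1, hi2⟩ := Finset.mem_Ico.1 hi
  rw [hp i (by omega), hc2 (2 * h - i) (by omega) (by omega), hε2 i (by omega), Nat.sub_sub_self (by omega)]
  push_cast
  ring

/-- Removing odd terms from a sum fixed by an automorphism negating `ω`. -/
lemma even_part_of_fixed [CharZero F] (α : F →+* F) (hα : α ω = -ω) (c : ℕ → ℤ) (n : ℕ)
    (hc : α (∑ i ∈ Finset.range (2 * n), (c i : F) * ω ^ i) =
      ∑ i ∈ Finset.range (2 * n), (c i : F) * ω ^ i) :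
    ∑ i ∈ Finset.range (2 * n), (c i : F) * ω ^ i =
      ∑ i ∈ Finset.range n, (c (2 * i) : F) * (ω ^ 2) ^ i := by
  have key : ∑ i ∈ Finset.range (2 * n), (c i : F) * ω ^ i +
      α (∑ i ∈ Finset.range (2 * n), (c i : F) * ω ^ i) =
      2 * ∑ i ∈ Finset.range n, (c (2 * i) : F) * (ω ^ 2) ^ i := by
    clear hc
    induction n with
    | zero => simp
    | succ n ih =>
      rw [show 2 * (n + 1) = 2 * n + 1 + 1 by ring, Finset.sum_range_succ, Finset.sum_range_succ,
        Finset.sum_range_succ _ n, mul_add, ← ih]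
      simp only [map_add, map_mul, map_intCast, map_pow, hα]
      rw [Even.neg_pow (by simp), Odd.neg_pow (by simp), pow_mul]
      ring
  rw [hc, ← two_mul] at key
  exact mul_left_cancel₀ two_ne_zero key

/-- Removing even terms from a sum negated by an automorphism negating `ω`. -/
lemma odd_part_of_negated [CharZero F] (α : F →+* F) (hα : α ω = -ω) (c : ℕ → ℤ) (n : ℕ)
    (hc : α (∑ i ∈ Finset.range n, (c i : F) * ω ^ i) =
      -∑ i ∈ Finset.range n, (c i : F) * ω ^ i) :
    ∑ i ∈ Finset.range n, (c i : F) * ω ^ i =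
      ∑ i ∈ Finset.range n, ((if Odd i then c i else 0 : ℤ) : F) * ω ^ i := by
  have key : ∑ i ∈ Finset.range n, (c i : F) * ω ^ i -
      α (∑ i ∈ Finset.range n, (c i : F) * ω ^ i) =
      2 * ∑ i ∈ Finset.range n, ((if Odd i then c i else 0 : ℤ) : F) * ω ^ i := by
    rw [map_sum, ← Finset.sum_sub_distrib, Finset.mul_sum]
    refine Finset.sum_congr rfl fun i _ => ?_
    rw [map_mul, map_intCast, map_pow, hα]
    split_ifs with h1
    · rw [h1.neg_pow]; ring
    · rw [(Nat.not_odd_iff_even.1 h1).neg_pow]; simp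
  rw [hc, sub_neg_eq_add, ← two_mul] at key
  exact mul_left_cancel₀ two_ne_zero key

lemma sum_abs_even_le (c : ℕ → ℤ) (n : ℕ) :
    ∑ i ∈ Finset.range n, |c (2 * i)| ≤ ∑ i ∈ Finset.range (2 * n), |c i| := by
  induction n with
  | zero => simp
  | succ n ih =>
    rw [show 2 * (n + 1) = 2 * n + 1 + 1 by ring, Finset.sum_range_succ, Finset.sum_range_succ,
      Finset.sum_range_succ]
    have := abs_nonneg (c (2 * n + 1))
    linarith

end Coordinates

open Polynomial in
theorem two_pow_mem_of_sum_abs_coeff_le {w n s : ℕ} (J : Ideal ℤ[X])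
    (hX : X ^ 2 ^ w + 1 ∈ J) (h2 : (2 : ℤ[X]) ^ n ∈ J) {p : ℤ[X]} (hp : p ∈ J) (hp0 : p ≠ 0)
    (hdeg : p.natDegree < 2 ^ w) (hsum : ∑ i ∈ Finset.range (2 ^ w), |p.coeff i| ≤ 2 ^ s) :
    (2 : ℤ[X]) ^ s ∈ J := by
  rcases dvd_coeff_or_two_pow_mem J hX h2 hp hdeg s with H | H
  swap
  · exact H
  set k := p.natDegree with hk
  have hlc : p.coeff k ≠ 0 := by simpa [hk] using hp0
  have hge : (2 : ℤ) ^ s ≤ |p.coeff k| :=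
    Int.le_of_dvd (abs_pos.mpr hlc) ((dvd_abs _ _).mpr (H k))
  have hkm : k ∈ Finset.range (2 ^ w) := Finset.mem_range.mpr hdeg
  have hrest := Finset.add_sum_erase _ (fun i => |p.coeff i|) hkm
  have hnn : ∀ i ∈ (Finset.range (2 ^ w)).erase k, 0 ≤ |p.coeff i| := fun _ _ => abs_nonneg _
  have hS := Finset.sum_nonneg hnn
  have hS0 : ∑ i ∈ (Finset.range (2 ^ w)).erase k, |p.coeff i| = 0 := by
    linarith
  have hk2 : |p.coeff k| = 2 ^ s := by
    linarith
  have hz : ∀ i, i ≠ k → p.coeff i = 0 := by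
    intro i hi
    by_cases hlt : i < 2 ^ w
    · have := (Finset.sum_eq_zero_iff_of_nonneg hnn).mp hS0 i
        (Finset.mem_erase.mpr ⟨hi, Finset.mem_range.mpr hlt⟩)
      exact abs_eq_zero.mp this
    · exact coeff_eq_zero_of_natDegree_lt (by omega)
  have hpe : p = C (p.coeff k) * X ^ k := by
    ext i
    rw [coeff_C_mul_X_pow]
    split_ifs with hi
    · rw [hi]
    · exact hz i hi
  have hmul : C (p.coeff k) * X ^ 2 ^ w ∈ J := by
    have h1 := J.mul_mem_left (X ^ (2 ^ w - k)) hp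
    have h3 : X ^ (2 ^ w - k) * p = C (p.coeff k) * X ^ 2 ^ w := by
      conv_lhs => rw [hpe]
      rw [mul_left_comm, ← pow_add, Nat.sub_add_cancel hdeg.le]
    rwa [h3] at h1
  have hC : C (p.coeff k) ∈ J := by
    have h1 := J.sub_mem (J.mul_mem_left (C (p.coeff k)) hX) hmul
    have h3 : C (p.coeff k) * (X ^ 2 ^ w + 1) - C (p.coeff k) * X ^ 2 ^ w = C (p.coeff k) := by
      ring
    rwa [h3] at h1
  have h4 : (C ((2 : ℤ) ^ s) : ℤ[X]) = 2 ^ s := by simp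
  rcases abs_eq (by positivity : (0 : ℤ) ≤ 2 ^ s) |>.mp hk2 with h | h
  · rw [h, h4] at hC
    exact hC
  · rw [h, C_neg, h4] at hC
    simpa using J.neg_mem hC

/-- The ideal of integer polynomials in `τ` which send `θ` into the `τ`-stable subgroup `R`. -/
def transporter {F : Type*} [AddCommGroup F] (T : Module.End ℤ F) (R : Submodule ℤ F)
    (hR : ∀ z ∈ R, T z ∈ R) (θ : F) : Ideal (Polynomial ℤ) where
  carrier := {p | Polynomial.aeval T p θ ∈ R}
  zero_mem' := by simp
  add_mem' {p q} hp hq := by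
    simp only [Set.mem_ofPred_eq, map_add, LinearMap.add_apply] at hp hq ⊢
    exact R.add_mem hp hq
  smul_mem' q p hp := by
    have key : ∀ q : Polynomial ℤ, ∀ z ∈ R, Polynomial.aeval T q z ∈ R := by
      intro q
      induction q using Polynomial.induction_on' with
      | add p q hp hq =>
        intro z hz
        rw [map_add, LinearMap.add_apply]
        exact R.add_mem (hp z hz) (hq z hz)
      | monomial n c =>
        intro z hz
        rw [Polynomial.aeval_monomial, ← Algebra.smul_def, LinearMap.smul_apply]
        refine R.smul_mem _ ?_
        induction n with
        | zero => simpa using hz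
        | succ n ih =>
          rw [pow_succ', Module.End.mul_apply]
          exact hR _ ih
    simp only [Set.mem_ofPred_eq, smul_eq_mul, map_mul, Module.End.mul_apply] at hp ⊢
    exact key q _ hp

section Orbit

variable {F : Type*} [Field F]

theorem iterate_pow_eq {ω : F} (τ : F →+* F) (hτ : τ ω = ω ^ 5) (s b : ℕ) :
    τ^[s] (ω ^ b) = ω ^ (b * 5 ^ s) := by
  induction s generalizing b with
  | zero => simp
  | succ s ih =>
    rw [Function.iterate_succ_apply, map_pow, hτ, ← pow_mul, ih]
    congr 1; ring

theorem iterate_two_pow_eq_neg {t : ℕ} {ω : F} (hω : ω ^ 2 ^ (t + 2) = -1) (τ : F →+* F)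
    (hτ : τ ω = ω ^ 5) {a : ℕ} (ha : Odd a) :
    τ^[2 ^ t] (ω + ω ^ a) = -(ω + ω ^ a) := by
  have hω1 : ω ^ 2 ^ (t + 3) = 1 := by
    rw [pow_succ 2 (t + 2), pow_mul, hω]; ring
  have hiω : τ^[2 ^ t] ω = -ω := by
    have := iterate_pow_eq τ hτ (2 ^ t) 1
    rw [pow_one, one_mul, pow_eq_pow_of_modEq (five_pow_two_pow_modEq t) hω1, pow_add, hω] at this
    rw [this]; ring
  rw [← RingHom.coe_pow, map_add, map_pow, RingHom.coe_pow, hiω, ha.neg_pow]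
  ring

theorem exists_iterate_eq {t : ℕ} {ω : F} (hω : ω ^ 2 ^ (t + 2) = -1) (τ α : F →+* F)
    (hτ : τ ω = ω ^ 5) {a : ℕ} (ha : a % 4 = 3) (hαω : α ω = ω ^ a) (hαα : α (α ω) = ω)
    {i : ℕ} (hi : Odd i) :
    ∃ s < 2 ^ t, ∃ η : ℤ, (η = 1 ∨ η = -1) ∧
      ω ^ i + α (ω ^ i) = η * τ^[s] (ω + α ω) := by
  have hω1 : ω ^ 2 ^ (t + 3) = 1 := by
    rw [pow_succ 2 (t + 2), pow_mul, hω]; ring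
  have hτp := iterate_pow_eq τ hτ
  have hadd : ∀ s x y, τ^[s] (x + y) = τ^[s] x + τ^[s] y := fun s x y => by
    rw [← RingHom.coe_pow, map_add]
  have hθ : ∀ s, τ^[s] (ω + α ω) = ω ^ 5 ^ s + α (ω ^ 5 ^ s) := by
    intro s
    rw [hadd, map_pow, hαω, hτp]
    have := hτp s 1
    rw [pow_one, one_mul] at this
    rw [this, ← pow_mul]
  have hq : τ^[2 ^ t] (ω + α ω) = -(ω + α ω) := by
    rw [hαω]
    exact iterate_two_pow_eq_neg hω τ hτ (Nat.odd_iff.mpr (by omega))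
  have hneg : ∀ s x, τ^[s] (-x) = - τ^[s] x := fun s x => by
    rw [← RingHom.coe_pow, map_neg]
  have hqu : ∀ u, τ^[2 ^ t * u] (ω + α ω) = (((-1) ^ u : ℤ) : F) * (ω + α ω) := by
    intro u
    induction u with
    | zero => simp
    | succ u ih =>
      rw [Nat.mul_succ, Function.iterate_add_apply, hq, hneg, ih]
      push_cast; ring
  have h1 : ∀ i : ℕ, i % 4 = 1 → ∃ s < 2 ^ t, ∃ η : ℤ, (η = 1 ∨ η = -1) ∧
      ω ^ i + α (ω ^ i) = η * τ^[s] (ω + α ω) := by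
    intro i hi
    obtain ⟨s, hs⟩ := exists_five_pow_modEq hi (t + 3)
    refine ⟨s % 2 ^ t, Nat.mod_lt _ (by positivity), (-1) ^ (s / 2 ^ t),
      neg_one_pow_eq_or ℤ _, ?_⟩
    rw [← pow_eq_pow_of_modEq hs hω1, ← hθ]
    conv_lhs => rw [← Nat.mod_add_div s (2 ^ t), Function.iterate_add_apply, hqu]
    rw [← RingHom.coe_pow, map_mul, map_intCast]
  have h4 : i % 4 = 1 ∨ i % 4 = 3 := by
    have := Nat.odd_iff.mp hi
    omega
  rcases h4 with h4 | h4
  · exact h1 i h4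
  · have h5 : (a * i) % 4 = 1 := by rw [Nat.mul_mod, ha, h4]
    obtain ⟨s, hs, η, hη, H⟩ := h1 _ h5
    refine ⟨s, hs, η, hη, ?_⟩
    rw [← H, pow_mul, ← hαω, map_pow, map_pow, hαα, add_comm]

theorem two_pow_mul_add_mem [CharZero F] {t m n a : ℕ} {ω : F} (hω : ω ^ 2 ^ (t + 2) = -1)
    (hli : ∀ c : ℕ → ℤ, ∑ i ∈ Finset.range (2 ^ (t + 2)), (c i : F) * ω ^ i = 0 →
      ∀ i < 2 ^ (t + 2), c i = 0)
    (R : Subring F) (τ α : F →+* F) (hτ : τ ω = ω ^ 5) (hR : ∀ z ∈ R, τ z ∈ R)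
    (ha : a % 4 = 3) (hαω : α ω = ω ^ a) {ε : ℤ} (hε : ε = 1 ∨ ε = -1) (hα : α ω * ω = ε)
    (h2 : 2 ^ n * (ω + α ω) ∈ R) {y : F} (hyR : y ∈ R) (hy0 : y ≠ 0) (hαy : α y = y)
    (c : ℕ → ℤ) (hc : y = ∑ i ∈ Finset.range (2 ^ (t + 2)), (c i : F) * ω ^ i)
    (hce : ∀ i, Even i → c i = 0)
    (hsum : ∑ i ∈ Finset.range (2 ^ (t + 2)), |c i| ≤ 2 ^ m) :
    1 ≤ m ∧ ∀ i, Odd i → 2 ^ (m - 1) * (ω ^ i + α (ω ^ i)) ∈ R := by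
  have hω0 : ω ≠ 0 := by
    rintro rfl
    simp at hω
  have hαα : α (α ω) = ω := by
    have h1 : α ω = ε * ω⁻¹ := by rw [← hα]; field_simp
    rw [h1, map_mul, map_intCast, map_inv₀, h1, mul_inv, inv_inv]
    rcases hε with rfl | rfl <;> simp
  have hpow : 2 ^ (t + 2) = 2 * 2 ^ (t + 1) := by ring
  have hfix := coords_of_fixed (h := 2 ^ (t + 1)) (by positivity)
    (by rw [pow_succ]; exact even_two.mul_left _) (by rw [← hpow]; exact hω)
    (by rw [← hpow]; exact hli) α hε hα c (by rw [← hpow, ← hc]; exact hαy)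
  rw [← hpow, ← hc, hce 0 (by simp)] at hfix
  obtain ⟨habs, hy⟩ := hfix
  have hsum2 : 2 * ∑ i ∈ Finset.Ico 1 (2 ^ (t + 1)), |c i| ≤ 2 ^ m := by
    refine le_trans ?_ hsum
    rw [hpow, sum_range_two_mul_reflect _ (by positivity), Finset.mul_sum]
    have : ∑ i ∈ Finset.Ico 1 (2 ^ (t + 1)), 2 * |c i| =
        ∑ i ∈ Finset.Ico 1 (2 ^ (t + 1)), (|c i| + |c (2 * 2 ^ (t + 1) - i)|) := by
      refine Finset.sum_congr rfl fun i hi => ?_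
      rw [Finset.mem_Ico] at hi
      rw [← hpow, habs i (by omega) (by omega)]; ring
    rw [this]
    have h0 := abs_nonneg (c 0)
    have h1 := abs_nonneg (c (2 ^ (t + 1)))
    linarith
  have hch : ∀ i : ℕ, ∃ s : ℕ, ∃ η : ℤ, s < 2 ^ t ∧ |η| = 1 ∧
      (c i : F) * (ω ^ i + α (ω ^ i)) = c i * (η * τ^[s] (ω + α ω)) := by
    intro i
    rcases Nat.even_or_odd i with he | ho
    · exact ⟨0, 1, by positivity, by simp, by simp [hce i he]⟩
    · obtain ⟨s, hs, η, hη, h⟩ := exists_iterate_eq hω τ α hτ ha hαω hαα ho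
      exact ⟨s, η, hs, by rcases hη with rfl | rfl <;> simp, by rw [h]⟩
  choose s η hs hη hsη using hch
  let T : Module.End ℤ F := τ.toAddMonoidHom.toIntLinearMap
  have hT : ∀ k z, (T ^ k) z = τ^[k] z := by
    intro k z
    rw [Module.End.pow_apply]; rfl
  let R' : Submodule ℤ F := R.toAddSubgroup.toIntSubmodule
  have hR' : ∀ z, z ∈ R' ↔ z ∈ R := fun z => Iff.rfl
  let J := transporter T R' hR (ω + α ω)
  have hJ : ∀ p, p ∈ J ↔ Polynomial.aeval T p (ω + α ω) ∈ R := fun p => Iff.rfl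
  let p : Polynomial ℤ := ∑ i ∈ Finset.Ico 1 (2 ^ (t + 1)), Polynomial.monomial (s i) (c i * η i)
  have hpy : Polynomial.aeval T p (ω + α ω) = y := by
    rw [hy]
    simp only [p, map_sum, LinearMap.sum_apply, Polynomial.aeval_monomial, ← Algebra.smul_def,
      LinearMap.smul_apply, hT, hsη]
    rw [Int.cast_zero, zero_add]
    refine Finset.sum_congr rfl fun i _ => ?_
    rw [zsmul_eq_mul]; push_cast; ring
  have hp0 : p ≠ 0 := by
    intro h
    rw [h] at hpy
    simp at hpy
    exact hy0 hpy.symm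
  have hdeg : p.natDegree < 2 ^ t := by
    refine lt_of_le_of_lt (Polynomial.natDegree_sum_le_of_forall_le _ _ (n := 2 ^ t - 1) ?_) ?_
    · intro i _
      exact (Polynomial.natDegree_monomial_le _).trans (by have := hs i; omega)
    · have : 0 < 2 ^ t := by positivity
      omega
  have hcoeff : ∑ k ∈ Finset.range (2 ^ t), |p.coeff k| ≤
      ∑ i ∈ Finset.Ico 1 (2 ^ (t + 1)), |c i| := by
    calc ∑ k ∈ Finset.range (2 ^ t), |p.coeff k|
        ≤ ∑ k ∈ Finset.range (2 ^ t), ∑ i ∈ Finset.Ico 1 (2 ^ (t + 1)),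
            (if s i = k then |c i| else 0) := by
          refine Finset.sum_le_sum fun k _ => ?_
          simp only [p, Polynomial.finsetSum_coeff, Polynomial.coeff_monomial]
          refine (Finset.abs_sum_le_sum_abs _ _).trans (Finset.sum_le_sum fun i _ => ?_)
          split_ifs
          · rw [abs_mul, hη, mul_one]
          · simp
      _ = ∑ i ∈ Finset.Ico 1 (2 ^ (t + 1)), |c i| := by
          rw [Finset.sum_comm]
          refine Finset.sum_congr rfl fun i _ => ?_
          rw [Finset.sum_ite_eq, if_pos (Finset.mem_range.mpr (hs i))]
  have hm : 1 ≤ m := by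
    by_contra hm
    obtain rfl : m = 0 := by omega
    have h1 : ∑ i ∈ Finset.Ico 1 (2 ^ (t + 1)), |c i| ≤ 0 := by
      rw [pow_zero] at hsum2; omega
    have h2 := Polynomial.leadingCoeff_ne_zero.mpr hp0
    have h3 := Finset.single_le_sum (f := fun k => |p.coeff k|) (fun _ _ => abs_nonneg _)
      (Finset.mem_range.mpr hdeg)
    have h4 : 0 < |p.coeff p.natDegree| := abs_pos.mpr h2
    linarith
  have hq : τ^[2 ^ t] (ω + α ω) = -(ω + α ω) := by
    rw [hαω]
    exact iterate_two_pow_eq_neg hω τ hτ (Nat.odd_iff.mpr (by omega))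
  have hmem : (2 : Polynomial ℤ) ^ (m - 1) ∈ J := by
    refine two_pow_mem_of_sum_abs_coeff_le (w := t) (n := n) J ?_ ?_ (p := p) ?_ hp0 hdeg ?_
    · rw [hJ]
      have h5 : Polynomial.aeval T (Polynomial.X ^ 2 ^ t + 1 : Polynomial ℤ) (ω + α ω) = 0 := by
        have h6 : Polynomial.aeval T (Polynomial.X ^ 2 ^ t + 1 : Polynomial ℤ) = T ^ 2 ^ t + 1 := by
          simp
        rw [h6, LinearMap.add_apply, hT, hq, Module.End.one_apply, neg_add_cancel]
      rw [h5]
      exact R.zero_mem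
    · rw [hJ]
      have h4 : (2 : Polynomial ℤ) ^ n = Polynomial.C ((2 : ℤ) ^ n) := by simp
      rw [h4, Polynomial.aeval_C, Algebra.algebraMap_eq_smul_one, LinearMap.smul_apply,
        Module.End.one_apply, zsmul_eq_mul]
      push_cast
      exact h2
    · rw [hJ, hpy]
      exact hyR
    · refine hcoeff.trans ?_
      have : (2 : ℤ) ^ m = 2 * 2 ^ (m - 1) := by
        rw [← pow_succ', Nat.sub_add_cancel hm]
      linarith
  refine ⟨hm, fun i hi => ?_⟩
  have hθ : 2 ^ (m - 1) * (ω + α ω) ∈ R := by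
    rw [hJ] at hmem
    have h4 : (2 : Polynomial ℤ) ^ (m - 1) = Polynomial.C ((2 : ℤ) ^ (m - 1)) := by simp
    rw [h4, Polynomial.aeval_C, Algebra.algebraMap_eq_smul_one, LinearMap.smul_apply,
        Module.End.one_apply, zsmul_eq_mul] at hmem
    push_cast at hmem
    exact hmem
  obtain ⟨k, _, e, _, h⟩ := exists_iterate_eq hω τ α hτ ha hαω hαα hi
  have hstab : ∀ k, ∀ z ∈ R, τ^[k] z ∈ R := by
    intro k
    induction k with
    | zero => exact fun z hz => hz
    | succ k ih => intro z hz; rw [Function.iterate_succ_apply]; exact ih _ (hR z hz)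
  have h5 := R.mul_mem (intCast_mem R e) (hstab k _ hθ)
  rw [← RingHom.coe_pow, map_mul, map_pow, map_ofNat, RingHom.coe_pow] at h5
  rw [h]
  convert h5 using 1
  ring

end Orbit

section CyclotomicTower

theorem exists_algEquiv_pow {e : ℕ} {F : Type} [Field F] [NumberField F]
    [IsCyclotomicExtension {2 ^ e} ℚ F] {ζ : F} (hζ : IsPrimitiveRoot ζ (2 ^ e)) {b : ℕ}
    (hb : Odd b) : ∃ σ : F ≃ₐ[ℚ] F, σ ζ = ζ ^ b := by
  have hcop : b.Coprime (2 ^ e) := Nat.Coprime.pow_right _ (Nat.coprime_two_right.mpr hb)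
  refine ⟨(IsCyclotomicExtension.Rat.galEquivZMod (2 ^ e) F).symm (ZMod.unitOfCoprime b hcop), ?_⟩
  rw [IsCyclotomicExtension.Rat.galEquivZMod_apply_of_pow_eq (2 ^ e) F _ hζ.pow_eq_one,
    MulEquiv.apply_symm_apply, ZMod.coe_unitOfCoprime, ZMod.val_natCast]
  exact pow_eq_pow_of_modEq (Nat.mod_modEq _ _) hζ.pow_eq_one

theorem exists_algEquiv_eq_pow {e : ℕ} (he : 0 < e) {F : Type} [Field F] [NumberField F]
    [IsCyclotomicExtension {2 ^ e} ℚ F] {ζ : F} (hζ : IsPrimitiveRoot ζ (2 ^ e))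
    (σ : F ≃ₐ[ℚ] F) : ∃ b : ℕ, Odd b ∧ σ ζ = ζ ^ b := by
  refine ⟨_, ?_, IsCyclotomicExtension.Rat.galEquivZMod_apply_of_pow_eq (2 ^ e) F σ hζ.pow_eq_one⟩
  have := ZMod.val_coe_unit_coprime (IsCyclotomicExtension.Rat.galEquivZMod (2 ^ e) F σ)
  exact Nat.coprime_two_right.mp ((Nat.coprime_pow_right_iff he _ _).mp this)

theorem pow_two_pow_eq_neg_one {F : Type*} [Field F] {ω : F} {u : ℕ}
    (hω : IsPrimitiveRoot ω (2 ^ (u + 1))) : ω ^ 2 ^ u = -1 := by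
  have h1 : (ω ^ 2 ^ u) ^ 2 = 1 := by rw [← pow_mul, ← pow_succ, hω.pow_eq_one]
  rcases eq_or_eq_neg_of_sq_eq_sq (ω ^ 2 ^ u) 1 (by rw [h1, one_pow]) with h | h
  · exact absurd h (hω.pow_ne_one_of_pos_of_lt (by positivity)
      (Nat.pow_lt_pow_right (by norm_num) (by omega)))
  · exact h

theorem coeff_eq_zero_of_sum_pow_eq_zero {F : Type*} [Field F] [CharZero F] {ω : F} {u : ℕ}
    (hω : IsPrimitiveRoot ω (2 ^ (u + 1))) (c : ℕ → ℤ)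
    (hc : ∑ i ∈ Finset.range (2 ^ u), (c i : F) * ω ^ i = 0) : ∀ i < 2 ^ u, c i = 0 := by
  have hdeg : (minpoly ℚ ω).natDegree = 2 ^ u := by
    rw [← Polynomial.cyclotomic_eq_minpoly_rat hω (by positivity),
      Polynomial.natDegree_cyclotomic, Nat.totient_prime_pow_succ Nat.prime_two]
    simp
  have hli := linearIndependent_pow (K := ℚ) ω
  rw [hdeg] at hli
  have := Fintype.linearIndependent_iff.mp hli (fun i => (c i : ℚ)) (by
    rw [Finset.sum_range] at hc
    rw [← hc]
    refine Finset.sum_congr rfl fun i _ => ?_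
    rw [Algebra.smul_def]
    simp)
  intro i hi
  exact_mod_cast this ⟨i, hi⟩

theorem exists_coords_of_isIntegral {u : ℕ} {F : Type} [Field F] [NumberField F]
    [IsCyclotomicExtension {2 ^ (u + 1)} ℚ F] {ζ : F} (hζ : IsPrimitiveRoot ζ (2 ^ (u + 1)))
    {z : F} (hz : IsIntegral ℤ z) :
    ∃ c : ℕ → ℤ, z = ∑ i ∈ Finset.range (2 ^ u), (c i : F) * ζ ^ i := by
  have : Fact (Nat.Prime 2) := ⟨Nat.prime_two⟩
  have H := IsCyclotomicExtension.Rat.isIntegralClosure_adjoin_singleton_of_prime_pow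
    (p := 2) (k := u + 1) hζ
  obtain ⟨⟨w, hw⟩, rfl⟩ := H.isIntegral_iff.mp hz
  obtain ⟨p, rfl⟩ := Algebra.adjoin_mem_exists_aeval ℤ ζ hw
  have hmon : (Polynomial.X ^ 2 ^ u + 1 : Polynomial ℤ).Monic := by
    rw [← Polynomial.C_1]
    exact Polynomial.monic_X_pow_add_C 1 (by positivity)
  have hroot : Polynomial.aeval ζ (Polynomial.X ^ 2 ^ u + 1 : Polynomial ℤ) = 0 := by
    simp [pow_two_pow_eq_neg_one hζ]
  refine ⟨(p %ₘ (Polynomial.X ^ 2 ^ u + 1)).coeff, ?_⟩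
  have hdeg : (Polynomial.X ^ 2 ^ u + 1 : Polynomial ℤ).natDegree = 2 ^ u := by
    rw [← Polynomial.C_1]
    exact Polynomial.natDegree_X_pow_add_C
  have hlt : (p %ₘ (Polynomial.X ^ 2 ^ u + 1)).natDegree < 2 ^ u := by
    have := Polynomial.natDegree_modByMonic_lt p hmon (by
      intro h
      have h1 := congrArg Polynomial.natDegree h
      rw [hdeg, Polynomial.natDegree_one] at h1
      exact absurd h1 (by positivity))
    rwa [hdeg] at this
  change Polynomial.aeval ζ p = _
  rw [← Polynomial.aeval_modByMonic_eq_self_of_root hroot, Polynomial.aeval_eq_sum_range' hlt]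
  exact Finset.sum_congr rfl fun i _ => by rw [zsmul_eq_mul]

theorem exists_coords_of_fixed {F : Type*} [Field F] [CharZero F] {u : ℕ} {ζ : F} {y : F} {D : ℤ}
    (c : ℕ → ℤ) (hy : y = ∑ i ∈ Finset.range (2 ^ u), (c i : F) * ζ ^ i)
    (hD : ∑ i ∈ Finset.range (2 ^ u), |c i| ≤ D) (n : ℕ) (hn : n ≤ u)
    (hσ : ∀ i < n, ∃ σ : F →+* F, σ (ζ ^ 2 ^ i) = -ζ ^ 2 ^ i ∧ σ y = y) :
    ∃ d : ℕ → ℤ, y = ∑ i ∈ Finset.range (2 ^ (u - n)), (d i : F) * (ζ ^ 2 ^ n) ^ i ∧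
      ∑ i ∈ Finset.range (2 ^ (u - n)), |d i| ≤ D := by
  induction n with
  | zero => exact ⟨c, by simpa using hy, by simpa using hD⟩
  | succ n ih =>
    obtain ⟨d, hd, hdD⟩ := ih (by omega) fun i hi => hσ i (by omega)
    obtain ⟨σ, hσζ, hσy⟩ := hσ n (by omega)
    have hpow : 2 ^ (u - n) = 2 * 2 ^ (u - (n + 1)) := by
      rw [← pow_succ']
      congr 1
      omega
    rw [hpow] at hd hdD
    refine ⟨fun i => d (2 * i), ?_, (sum_abs_even_le _ _).trans hdD⟩
    have := even_part_of_fixed σ hσζ d (2 ^ (u - (n + 1))) (by rw [← hd, hσy])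
    rw [← hd] at this
    rw [this, ← pow_mul, ← pow_succ]

end CyclotomicTower

section Levels

/-- A set of odd exponents closed under multiplication and under congruence modulo `2 ^ e` has a
level `k`: among the exponents congruent to `1` modulo `4`, it contains exactly those which are
congruent to `1` modulo `2 ^ k`. -/
theorem exists_level {e : ℕ} (he : 2 ≤ e) (A : Set ℕ) (h1 : 1 ∈ A)
    (hmul : ∀ b ∈ A, ∀ c ∈ A, b * c ∈ A) (hmod : ∀ b ∈ A, ∀ c, b ≡ c [MOD 2 ^ e] → c ∈ A) :
    ∃ k, 2 ≤ k ∧ k ≤ e ∧ (∀ b, b % 2 ^ k = 1 → b ∈ A) ∧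
      ∀ b ∈ A, b % 4 = 1 → b % 2 ^ k = 1 := by
  classical
  have hlt : ∀ r, 2 ≤ r → 1 < 2 ^ r := fun r hr => Nat.one_lt_pow (by omega) (by norm_num)
  have hex : ∃ k, 2 ≤ k ∧ ∀ b, b % 2 ^ k = 1 → b ∈ A :=
    ⟨e, he, fun b hb => hmod 1 h1 b (by rw [Nat.ModEq, hb, Nat.mod_eq_of_lt (hlt e he)])⟩
  have hpow : ∀ b ∈ A, ∀ s, b ^ s ∈ A := by
    intro b hb s
    induction s with
    | zero => simpa using h1
    | succ s ih => rw [pow_succ]; exact hmul _ ih _ hb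
  have hk := Nat.find_spec hex
  refine ⟨Nat.find hex, hk.1, Nat.find_min' hex ⟨he, fun b hb => hmod 1 h1 b (by
    rw [Nat.ModEq, hb, Nat.mod_eq_of_lt (hlt e he)])⟩, hk.2, fun b hb hb4 => ?_⟩
  have key : ∀ r, 2 ≤ r → r ≤ Nat.find hex → b % 2 ^ r = 1 := by
    intro r hr
    induction r, hr using Nat.le_induction with
    | base => exact fun _ => hb4
    | succ r hr ih =>
      intro hrk
      have hbr := ih (by omega)
      by_contra hne
      have hc : b % 2 ^ (r + 1) = 1 + 2 ^ r := by
        rw [pow_succ, Nat.mod_mul, hbr] at hne ⊢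
        rcases Nat.mod_two_eq_zero_or_one (b / 2 ^ r) with h | h
        · rw [h] at hne; simp at hne
        · rw [h, mul_one]
      refine Nat.find_min hex (by omega) ⟨hr, fun b' hb' => ?_⟩
      obtain ⟨s, hs⟩ := exists_pow_modEq hr hc hb' e
      exact hmod _ (hpow b hb s) _ hs
  exact key _ hk.1 le_rfl

theorem two_pow_dvd_two_mul_succ {a k : ℕ} (ha : a % 4 = 3) (h : a * a % 2 ^ k = 1) :
    2 ^ k ∣ 2 * (a + 1) := by
  obtain ⟨b, rfl⟩ : ∃ b, a = 4 * b + 3 := ⟨a / 4, by omega⟩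
  have h1 : 2 ^ k ∣ (4 * b + 3) * (4 * b + 3) - 1 :=
    (Nat.modEq_iff_dvd' (by nlinarith)).mp (by
      have hk : k ≠ 0 := by rintro rfl; simp [Nat.mod_one] at h
      rw [Nat.ModEq, h, Nat.mod_eq_of_lt (Nat.one_lt_pow hk (by norm_num))])
  have h2 : (4 * b + 3) * (4 * b + 3) - 1 = (2 * b + 1) * (2 * (4 * b + 3 + 1)) := by
    have : (4 * b + 3) * (4 * b + 3) = (2 * b + 1) * (2 * (4 * b + 3 + 1)) + 1 := by ring
    omega
  rw [h2] at h1
  refine Nat.Coprime.dvd_of_dvd_mul_left (Nat.Coprime.pow_left _ ?_) h1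
  exact Nat.coprime_two_left.mpr ⟨b, rfl⟩

end Levels

section Galois

variable {G : Type} [Group G]

theorem charMonoid_apply_mem_charRing {f : G → ℂ} (hf : f ∈ charMonoid G) (h : G) :
    f h ∈ charRing G := by
  induction hf using AddSubmonoid.closure_induction with
  | mem f hf =>
    obtain ⟨V, hV, rfl⟩ := hf
    exact Subring.subset_closure ⟨V, hV, h, rfl⟩
  | zero => exact (charRing G).zero_mem
  | add f₁ f₂ _ _ h₁ h₂ => exact (charRing G).add_mem h₁ h₂

variable {u : ℕ} {F : Type} [Field F] [NumberField F] {ζ : F}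

theorem exists_character_lift (hζ : IsPrimitiveRoot ζ (2 ^ (u + 1))) (ι : F →+* ℂ)
    (hN : Nat.card G ∣ 2 ^ (u + 1)) (V : FDRep ℂ G) (h : G) :
    ∃ z : F, ι z = V.character h ∧
      (∀ (σ : F →+* F) (b : ℕ), σ ζ = ζ ^ b → ι (σ z) = V.character (h ^ b)) ∧
      ∃ d : ℕ → ℤ, z = ∑ c ∈ Finset.range (2 ^ u), (d c : F) * ζ ^ c ∧
        ∑ c ∈ Finset.range (2 ^ u), |d c| ≤ finrank ℂ V := by
  have hh : h ^ 2 ^ (u + 1) = 1 := by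
    obtain ⟨q, hq⟩ := hN
    rw [hq, pow_mul, pow_card_eq_one', one_pow]
  obtain ⟨m, hm, hmV⟩ := exists_multiplicity (N := 2 ^ (u + 1)) (by positivity)
    (hζ.map_of_injective ι.injective) V h hh
  refine ⟨∑ c ∈ Finset.range (2 ^ (u + 1)), (m c : F) * ζ ^ c, ?_, ?_, ?_⟩
  · have := hm 1
    rw [pow_one] at this
    simp [this, map_sum]
  · intro σ b hσ
    simp [hm b, map_sum, hσ, ← pow_mul, mul_comm]
  · refine ⟨fun c => m c - m (2 ^ u + c), ?_, ?_⟩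
    · rw [pow_succ, mul_two, Finset.sum_range_add, ← Finset.sum_add_distrib]
      refine Finset.sum_congr rfl fun c _ => ?_
      rw [pow_add, pow_two_pow_eq_neg_one hζ]
      push_cast
      ring
    · rw [← hmV, pow_succ, mul_two, Finset.sum_range_add, ← Finset.sum_add_distrib]
      push_cast
      refine Finset.sum_le_sum fun c _ => ?_
      rw [abs_le]
      constructor <;> omega

theorem exists_charFieldAt_lift (hζ : IsPrimitiveRoot ζ (2 ^ (u + 1))) (ι : F →+* ℂ)
    (hN : Nat.card G ∣ 2 ^ (u + 1)) (g : G) {x : ℂ}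
    (hx : x ∈ charFieldAt g) : ∃ z : F, ι z = x ∧
      ∀ (σ : F ≃ₐ[ℚ] F) (b : ℕ), σ ζ = ζ ^ b → IsConj g (g ^ b) → σ z = z := by
  have hle : charFieldAt g ≤ Subfield.map ι (⨅ σ : {σ : F ≃ₐ[ℚ] F // ∃ b : ℕ, σ ζ = ζ ^ b ∧
      IsConj g (g ^ b)}, RingHom.eqLocusField (σ.1 : F →+* F) (RingHom.id F)) := by
    refine Subfield.closure_le.mpr ?_
    rintro _ ⟨V, hV, rfl⟩
    obtain ⟨z, hz, hzσ, -⟩ := exists_character_lift hζ ι hN V g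
    refine ⟨z, Subfield.mem_iInf.mpr ?_, hz⟩
    rintro ⟨σ, b, hσ, hb⟩
    refine ι.injective ?_
    change ι ((σ : F →+* F) z) = ι z
    rw [hzσ σ b hσ, hz]
    obtain ⟨t, ht⟩ := isConj_iff.mp hb
    rw [← ht, V.char_conj]
  obtain ⟨z, hz, he⟩ := hle hx
  refine ⟨z, he, fun σ b hσ hb => ?_⟩
  exact Subfield.mem_iInf.mp hz ⟨σ, b, hσ, hb⟩

variable [IsCyclotomicExtension {2 ^ (u + 1)} ℚ F]

theorem map_mem_comap_charRing (hζ : IsPrimitiveRoot ζ (2 ^ (u + 1))) (ι : F →+* ℂ)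
    (hN : Nat.card G ∣ 2 ^ (u + 1)) (σ : F ≃ₐ[ℚ] F) {z : F}
    (hz : z ∈ (charRing G).comap ι) : σ z ∈ (charRing G).comap ι := by
  obtain ⟨b, -, hσ⟩ := exists_algEquiv_eq_pow (by omega) hζ σ
  have hle : charRing G ≤ (((charRing G).comap ι).comap (σ : F →+* F)).map ι := by
    refine Subring.closure_le.mpr ?_
    rintro _ ⟨V, hV, h, rfl⟩
    obtain ⟨z, hz, hzσ, -⟩ := exists_character_lift hζ ι hN V h
    refine ⟨z, ?_, hz⟩
    change ι ((σ : F →+* F) z) ∈ charRing G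
    rw [hzσ σ b hσ]
    exact Subring.subset_closure ⟨V, hV, _, rfl⟩
  obtain ⟨z', hz', he⟩ := hle hz
  rw [ι.injective he] at hz'
  exact hz'

theorem mem_charFieldAt_of_fixed (hζ : IsPrimitiveRoot ζ (2 ^ (u + 1))) (ι : F →+* ℂ)
    [Finite G] (hN : Nat.card G ∣ 2 ^ (u + 1)) (g : G) {z : F}
    (hz : ∀ (σ : F ≃ₐ[ℚ] F) (b : ℕ), Odd b → σ ζ = ζ ^ b → IsConj g (g ^ b) → σ z = z) :
    ι z ∈ charFieldAt g := by
  have : IsGalois ℚ F := IsCyclotomicExtension.isGalois {2 ^ (u + 1)} ℚ F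
  let K : IntermediateField ℚ F := Subfield.toIntermediateField ((charFieldAt g).comap ι) (by
    intro r
    change ι (algebraMap ℚ F r) ∈ charFieldAt g
    simp)
  suffices z ∈ K from this
  rw [← IsGalois.fixedField_fixingSubgroup K, IntermediateField.mem_fixedField_iff]
  intro σ hσ
  obtain ⟨b, hb, hσb⟩ := exists_algEquiv_eq_pow (by omega) hζ σ
  refine hz σ b hb hσb (isConj_of_character_eq g (g ^ b) fun V hV => ?_)
  obtain ⟨y, hy, hyσ, -⟩ := exists_character_lift hζ ι hN V g
  have hyK : y ∈ K := by
    change ι y ∈ charFieldAt g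
    rw [hy]
    exact Subfield.subset_closure ⟨V, hV, rfl⟩
  have h1 : (σ : F →+* F) y = y :=
    (IntermediateField.mem_fixingSubgroup_iff K σ).mp hσ y hyK
  rw [← hyσ σ b hσb, h1, hy]

end Galois

section ConjugateExponents

variable {G : Type} [Group G]

/-- The exponents `b` for which `g` is conjugate to `g ^ b`. -/
def conjExponents (g : G) : Set ℕ := {b | IsConj g (g ^ b)}

theorem one_mem_conjExponents (g : G) : 1 ∈ conjExponents g := by
  change IsConj g (g ^ 1)
  rw [pow_one]

theorem IsConj.pow_left_right {x y : G} (h : IsConj x y) (n : ℕ) : IsConj (x ^ n) (y ^ n) := by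
  obtain ⟨t, ht⟩ := isConj_iff.mp h
  exact isConj_iff.mpr ⟨t, by rw [← ht, conj_pow]⟩

theorem mul_mem_conjExponents {g : G} {b c : ℕ} (hb : b ∈ conjExponents g)
    (hc : c ∈ conjExponents g) : b * c ∈ conjExponents g := by
  have h1 := IsConj.pow_left_right (x := g) (y := g ^ b) hb c
  rw [← pow_mul] at h1
  exact IsConj.trans hc h1

theorem mem_conjExponents_of_mul_mem {g : G} {b c : ℕ} (hb : b ∈ conjExponents g)
    (hbc : b * c ∈ conjExponents g) : c ∈ conjExponents g := by
  have h1 := IsConj.pow_left_right (x := g) (y := g ^ b) hb c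
  rw [← pow_mul] at h1
  exact IsConj.trans hbc h1.symm

theorem mem_conjExponents_of_modEq {g : G} {n b c : ℕ} (hg : g ^ n = 1)
    (hb : b ∈ conjExponents g) (h : b ≡ c [MOD n]) : c ∈ conjExponents g := by
  have h1 : g ^ b = g ^ c := pow_eq_pow_of_modEq h hg
  change IsConj g (g ^ c)
  rw [← h1]
  exact hb

theorem eq_one_of_even_mem_conjExponents {g : G} {e b : ℕ} (hg : g ^ 2 ^ e = 1)
    (hb : b ∈ conjExponents g) (hev : Even b) : g = 1 := by
  have hpow : ∀ s, b ^ s ∈ conjExponents g := by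
    intro s
    induction s with
    | zero => simpa using one_mem_conjExponents g
    | succ s ih => rw [pow_succ]; exact mul_mem_conjExponents ih hb
  have h1 : IsConj g (g ^ b ^ e) := hpow e
  obtain ⟨q, hq⟩ := pow_dvd_pow_of_dvd hev.two_dvd e
  rw [hq, pow_mul, hg, one_pow] at h1
  exact isConj_one_left.mp h1

theorem card_conj_eq [Finite G] (g h : G) (hh : IsConj g h) :
    Nat.card {t : G // t⁻¹ * g * t = h} = Nat.card {t : G // t⁻¹ * g * t = g} := by
  obtain ⟨s, hs⟩ := isConj_iff.mp hh
  refine Nat.card_congr ((Equiv.mulRight s).subtypeEquiv fun t => ?_)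
  simp only [Equiv.coe_mulRight, mul_inv_rev, ← hs]
  constructor
  · intro h
    calc s⁻¹ * t⁻¹ * g * (t * s) = s⁻¹ * (t⁻¹ * g * t) * s := by group
      _ = g := by rw [h]; group
  · intro h
    calc t⁻¹ * g * t = s * (s⁻¹ * t⁻¹ * g * (t * s)) * s⁻¹ := by group
      _ = s * g * s⁻¹ := by rw [h]

theorem card_centralizer_dvd [Finite G] (g : G) :
    Nat.card {t : G // t⁻¹ * g * t = g} ∣ Nat.card G := by
  have : Nat.card {t : G // t⁻¹ * g * t = g} = Nat.card (Subgroup.centralizer {g}) := by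
    refine Nat.card_congr (Equiv.subtypeEquivRight fun t => ?_)
    rw [Subgroup.mem_centralizer_singleton_iff, mul_assoc, inv_mul_eq_iff_eq_mul, eq_comm]
  rw [this]
  exact Subgroup.card_subgroup_dvd_card _

theorem sum_range_mul_of_periodic {M : Type*} [CommRing M] (f : ℕ → M) (n q : ℕ)
    (hf : ∀ i, f (i + n) = f i) :
    ∑ i ∈ Finset.range (n * q), f i = q * ∑ i ∈ Finset.range n, f i := by
  have hper : ∀ q i, f (n * q + i) = f i := by
    intro q i
    induction q with
    | zero => simp
    | succ q ih => rw [Nat.mul_succ, ← ih, ← hf (n * q + i)]; congr 1; ring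
  induction q with
  | zero => simp
  | succ q ih =>
    rw [Nat.mul_succ, Finset.sum_range_add, ih]
    simp only [hper]
    push_cast
    ring

end ConjugateExponents

section TwoGroups

variable {G : Type} [Group G] [Finite G] {u : ℕ} {F : Type} [Field F] [NumberField F] {ζ : F}

theorem exists_two_pow_mul_add_mem_charRing (hζ : IsPrimitiveRoot ζ (2 ^ (u + 1))) (ι : F →+* ℂ)
    (hN : Nat.card G ∣ 2 ^ (u + 1)) {g : G} {k a : ℕ} (hk : 3 ≤ k) (hku : k ≤ u + 1)
    (hk1 : ∀ b, b % 2 ^ k = 1 → b ∈ conjExponents g)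
    (hk2 : ∀ b ∈ conjExponents g, b % 4 = 1 → b % 2 ^ k = 1)
    (ha : a ∈ conjExponents g) (ha4 : a % 4 = 3) (s : ℕ) (hs : (ζ ^ s) ^ 2 ^ k = 1) :
    ∃ n, 2 ^ n * (ζ ^ s + (ζ ^ s) ^ a) ∈ (charRing G).comap ι := by
  have hg : g ^ 2 ^ (u + 1) = 1 := by
    obtain ⟨q, hq⟩ := hN
    rw [hq, pow_mul, pow_card_eq_one', one_pow]
  have h8 : 8 ≤ 2 ^ k := by
    calc 8 = 2 ^ 3 := by norm_num
      _ ≤ 2 ^ k := Nat.pow_le_pow_right (by norm_num) hk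
  have h48 : 4 ∣ 2 ^ k := by
    have := pow_dvd_pow 2 (show 2 ≤ k by omega)
    norm_num at this
    exact this
  have hg1 : g ≠ 1 := by
    rintro rfl
    have h5 := hk2 5 (by simp [conjExponents]) (by norm_num)
    rw [Nat.mod_eq_of_lt (by omega)] at h5
    omega
  have haa : a * a % 2 ^ k = 1 :=
    hk2 _ (mul_mem_conjExponents ha ha) (by rw [Nat.mul_mod, ha4])
  have hacop : Nat.gcd (2 ^ k) a = 1 :=
    Nat.Coprime.pow_left _ (Nat.coprime_two_left.mpr (Nat.odd_iff.mpr (by omega)))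
  have ha1 : a % 2 ^ k ≠ 1 := by
    intro h
    have := Nat.mod_mod_of_dvd a h48
    rw [h, ha4] at this
    norm_num at this
  set ω := ζ ^ s with hω
  set C := Nat.card {t : G // t⁻¹ * g * t = g} with hC
  let f : ℕ → F := fun i =>
    (if i % 2 ^ k = 1 then ω else 0) + (if i % 2 ^ k = a % 2 ^ k then ω ^ a else 0)
  have hf : ∀ i, ω ^ i * (Nat.card {t : G // t⁻¹ * g * t = g ^ i} : F) = C * f i := by
    intro i
    by_cases hi : i ∈ conjExponents g
    · rw [card_conj_eq g _ hi, mul_comm]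
      congr 1
      have hodd : i % 4 = 1 ∨ i % 4 = 3 := by
        rcases Nat.even_or_odd i with h | h
        · exact absurd (eq_one_of_even_mem_conjExponents hg hi h) hg1
        · rw [Nat.odd_iff] at h
          omega
      rcases hodd with h | h
      · have h1 := hk2 i hi h
        simp only [f, h1, if_true]
        rw [if_neg (Ne.symm ha1), add_zero, ← Nat.mod_add_div i (2 ^ k), h1, pow_add, pow_mul, hs,
          one_pow, mul_one, pow_one]
      · have h1 : a * i % 2 ^ k = 1 :=
          hk2 _ (mul_mem_conjExponents ha hi) (by rw [Nat.mul_mod, ha4, h])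
        have h2 : i ≡ a [MOD 2 ^ k] :=
          Nat.ModEq.cancel_left_of_coprime hacop (by rw [Nat.ModEq, h1, haa])
        simp only [f]
        rw [h2, if_neg ha1, if_pos rfl, zero_add]
        exact pow_eq_pow_of_modEq h2 hs
    · have h0 : Nat.card {t : G // t⁻¹ * g * t = g ^ i} = 0 := by
        rw [Nat.card_eq_zero]
        left
        rw [isEmpty_subtype]
        intro t ht
        exact hi (isConj_iff.mpr ⟨t⁻¹, by rw [inv_inv]; exact ht⟩)
      have h1 : i % 2 ^ k ≠ 1 := fun h => hi (hk1 i h)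
      have h2 : i % 2 ^ k ≠ a % 2 ^ k := by
        intro h
        refine hi (mem_conjExponents_of_mul_mem ha (hk1 _ ?_))
        rw [← haa]
        exact Nat.ModEq.mul_left a h
      simp only [f]
      rw [h0, if_neg h1, if_neg h2]
      simp
  have hsum : ∑ i ∈ Finset.range (2 ^ (u + 1)), f i = 2 ^ (u + 1 - k) * (ω + ω ^ a) := by
    have h1 : 2 ^ (u + 1) = 2 ^ k * 2 ^ (u + 1 - k) := by
      rw [← pow_add, Nat.add_sub_cancel' hku]
    rw [h1, sum_range_mul_of_periodic f _ _ (fun i => by simp [f])]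
    push_cast
    congr 1
    have h2 : ∀ i ∈ Finset.range (2 ^ k), f i =
        (if i = 1 then ω else 0) + (if i = a % 2 ^ k then ω ^ a else 0) := by
      intro i hi
      simp only [f]
      rw [Nat.mod_eq_of_lt (Finset.mem_range.mp hi)]
    rw [Finset.sum_congr rfl h2, Finset.sum_add_distrib, Finset.sum_ite_eq', Finset.sum_ite_eq',
      if_pos (Finset.mem_range.mpr (by omega)),
      if_pos (Finset.mem_range.mpr (Nat.mod_lt _ (by positivity)))]
  obtain ⟨χ, hχ, hχN, -⟩ := exists_induced (N := 2 ^ (u + 1)) (by positivity)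
    (hζ.map_of_injective ι.injective) g hg
  have hval := hχN ((2 ^ (u + 1) - 1) * s) g
  have hinv : (ι ζ)⁻¹ ^ (2 ^ (u + 1) - 1) = ι ζ := by
    rw [inv_pow, inv_eq_iff_eq_inv]
    refine eq_inv_of_mul_eq_one_left ?_
    rw [← pow_succ, Nat.sub_add_cancel Nat.one_le_two_pow]
    exact (hζ.map_of_injective ι.injective).pow_eq_one
  have hval2 : (2 : ℂ) ^ (u + 1) * χ ((2 ^ (u + 1) - 1) * s) g =
      ι (C * (2 ^ (u + 1 - k) * (ω + ω ^ a))) := by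
    rw [← hsum, Finset.mul_sum, ← Finset.sum_congr rfl fun i _ => hf i, map_sum]
    push_cast at hval
    rw [hval]
    refine Finset.sum_congr rfl fun i _ => ?_
    rw [mul_assoc, pow_mul, hinv, map_mul, map_pow, hω, map_pow, map_natCast, pow_mul]
  obtain ⟨q, hq⟩ := (card_centralizer_dvd g).trans hN
  refine ⟨u + 1 + (u + 1 - k), ?_⟩
  rw [Subring.mem_comap]
  have h3 : (2 : F) ^ (u + 1 + (u + 1 - k)) * (ω + ω ^ a) =
      q * (C * (2 ^ (u + 1 - k) * (ω + ω ^ a))) := by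
    have : (2 : F) ^ (u + 1) = C * q := by exact_mod_cast hq
    rw [pow_add, this]
    ring
  rw [h3, map_mul, ← hval2, map_natCast]
  refine (charRing G).mul_mem (natCast_mem _ _) ((charRing G).mul_mem ?_
    (charMonoid_apply_mem_charRing (hχ _) g))
  exact pow_mem (ofNat_mem _ 2) _

variable [IsCyclotomicExtension {2 ^ (u + 1)} ℚ F]

theorem two_pow_mul_add_mem_charRing (hG : IsPGroup 2 G) (hζ : IsPrimitiveRoot ζ (2 ^ (u + 1)))
    (ι : F →+* ℂ) (hN : Nat.card G ∣ 2 ^ (u + 1)) {g : G} {k a m : ℕ}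
    (hM : sSup (degreeSet G) = 2 ^ m) (hku : k ≤ u + 1)
    (hk1 : ∀ b, b % 2 ^ k = 1 → b ∈ conjExponents g)
    (hk2 : ∀ b ∈ conjExponents g, b % 4 = 1 → b % 2 ^ k = 1)
    (ha : a ∈ conjExponents g) (ha4 : a % 4 = 3) (α : F ≃ₐ[ℚ] F) (hα : α ζ = ζ ^ a)
    {t : ℕ} (ht : t + 3 ≤ k) {i : ℕ} (hi : Odd i) :
    1 ≤ m ∧ 2 ^ (m - 1) * ((ζ ^ 2 ^ (u + 1 - (t + 3))) ^ i +
      α ((ζ ^ 2 ^ (u + 1 - (t + 3))) ^ i)) ∈ (charRing G).comap ι := by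
  set ω := ζ ^ 2 ^ (u + 1 - (t + 3)) with hωdef
  have hω : IsPrimitiveRoot ω (2 ^ (t + 2 + 1)) := by
    refine hζ.pow (by positivity) ?_
    rw [← pow_add]
    congr 1
    omega
  have hωneg := pow_two_pow_eq_neg_one hω
  have hmapω : ∀ (σ : F ≃ₐ[ℚ] F) b, σ ζ = ζ ^ b → σ ω = ω ^ b := by
    intro σ b hσ
    rw [hωdef, map_pow, hσ, pow_right_comm]
  obtain ⟨τ, hτ⟩ := exists_algEquiv_pow hζ (show Odd 5 by decide)
  have haa : a * a % 2 ^ k = 1 :=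
    hk2 _ (mul_mem_conjExponents ha ha) (by rw [Nat.mul_mod, ha4])
  have hαω2 : (α ω * ω) ^ 2 = 1 := by
    rw [hmapω α a hα, ← pow_succ, ← pow_mul, mul_comm, hω.pow_eq_one_iff_dvd]
    exact (pow_dvd_pow 2 ht).trans (two_pow_dvd_two_mul_succ ha4 haa)
  obtain ⟨ε, hε, hαωε⟩ : ∃ ε : ℤ, (ε = 1 ∨ ε = -1) ∧ α ω * ω = ε := by
    rcases eq_or_eq_neg_of_sq_eq_sq (α ω * ω) 1 (by rw [hαω2, one_pow]) with h | h
    · exact ⟨1, Or.inl rfl, by rw [h]; simp⟩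
    · exact ⟨-1, Or.inr rfl, by rw [h]; simp⟩
  obtain ⟨n, hn⟩ := exists_two_pow_mul_add_mem_charRing hζ ι hN (by omega) hku hk1 hk2 ha ha4
    (2 ^ (u + 1 - (t + 3))) (by
      rw [← hωdef, hω.pow_eq_one_iff_dvd]
      exact pow_dvd_pow 2 ht)
  -- a character which changes sign under the exponent `1 + 2 ^ (t + 2)`
  have hcA : ¬ IsConj g (g ^ (1 + 2 ^ (t + 2))) := by
    intro h
    have h1 := hk2 _ h (by
      rw [pow_add]
      omega)
    have h2 : 2 ^ (t + 2) < 2 ^ (t + 3) := Nat.pow_lt_pow_right (by norm_num) (by omega)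
    have h3 := Nat.ModEq.of_dvd (pow_dvd_pow 2 ht)
      (show 1 + 2 ^ (t + 2) ≡ 1 [MOD 2 ^ k] by
        rw [Nat.ModEq, h1, Nat.mod_eq_of_lt (Nat.one_lt_pow (by omega) (by norm_num))])
    rw [Nat.ModEq, Nat.mod_eq_of_lt, Nat.mod_eq_of_lt] at h3
    · have : 0 < 2 ^ (t + 2) := by positivity
      omega
    · exact Nat.one_lt_pow (by omega) (by norm_num)
    · have : 4 ≤ 2 ^ (t + 2) := by
        rw [pow_add]
        have := Nat.one_le_two_pow (n := t)
        omega
      rw [pow_succ 2 (t + 2)]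
      omega
  obtain ⟨V, hV, hVneg, hV0⟩ := exists_character_eq_neg _ G rfl hG g _ hcA
  obtain ⟨y, hy, hyσ, d, hyd, hdV⟩ := exists_character_lift hζ ι hN V g
  have hVM : (finrank ℂ V : ℤ) ≤ 2 ^ m := by
    have h1 : finrank ℂ V ≤ sSup (degreeSet G) := le_csSup bddAbove_degreeSet ⟨V, hV, rfl⟩
    rw [hM] at h1
    exact_mod_cast h1
  obtain ⟨γ, hγ⟩ := exists_algEquiv_pow hζ (b := 1 + 2 ^ (t + 2)) (by
    rw [pow_succ', Nat.odd_iff]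
    omega)
  have hγy : γ y = -y := by
    refine ι.injective ?_
    rw [map_neg, hy, ← hVneg]
    exact hyσ γ _ hγ
  have hγω : γ ω = -ω := by
    rw [hmapω γ _ hγ, pow_add, hωneg]
    ring
  have hαy : α y = y := by
    refine ι.injective ((hyσ α _ hα).trans ?_)
    obtain ⟨s, hs⟩ := isConj_iff.mp ha
    rw [← hs, V.char_conj, hy]
  have hfix : ∀ i < u + 1 - (t + 3), ∃ σ : F →+* F, σ (ζ ^ 2 ^ i) = -ζ ^ 2 ^ i ∧ σ y = y := by
    intro i hi
    have hc2 : (1 + 2 ^ (t + 2)) * (1 + 2 ^ (t + 2)) % 2 ^ (t + 3 + 1) = 1 + 2 ^ (t + 3) := by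
      have h1 : (1 + 2 ^ (t + 2)) * (1 + 2 ^ (t + 2)) =
          1 + 2 ^ (t + 3) + 2 ^ (t + 3 + 1) * 2 ^ t := by ring
      rw [h1, Nat.add_mul_mod_self_left, Nat.mod_eq_of_lt]
      have : 1 < 2 ^ (t + 3) := Nat.one_lt_pow (by omega) (by norm_num)
      rw [pow_succ 2 (t + 3)]
      omega
    have hb : (1 + 2 ^ (u - i)) % 2 ^ (t + 3) = 1 := by
      obtain ⟨q, hq⟩ := pow_dvd_pow 2 (show t + 3 ≤ u - i by omega)
      rw [hq, Nat.add_mul_mod_self_left, Nat.mod_eq_of_lt]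
      exact Nat.one_lt_pow (by omega) (by norm_num)
    obtain ⟨s, hs⟩ := exists_pow_modEq (by omega) hc2 hb (u + 1)
    have hγ2 : ∀ s, ((fun x => γ (γ x))^[s]) y = y := by
      intro s
      refine Function.iterate_fixed ?_ s
      simp only [hγy, map_neg, neg_neg]
    have hγζ : ∀ s, ((fun x => γ (γ x))^[s]) ζ = ζ ^ ((1 + 2 ^ (t + 2)) * (1 + 2 ^ (t + 2))) ^ s := by
      intro s
      induction s with
      | zero => simp
      | succ s ih =>
        rw [Function.iterate_succ_apply', ih, map_pow, map_pow, hγ, map_pow, hγ, ← pow_mul,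
          ← pow_mul]
        congr 1
        ring
    let σ : F →+* F := ((γ : F →+* F).comp (γ : F →+* F)) ^ s
    have hσ : ∀ x, σ x = ((fun x => γ (γ x))^[s]) x := by
      intro x
      simp only [σ]
      rw [RingHom.coe_pow]
      rfl
    refine ⟨σ, ?_, by rw [hσ, hγ2]⟩
    rw [map_pow, hσ, hγζ, pow_eq_pow_of_modEq hs hζ.pow_eq_one, pow_right_comm, pow_add, pow_one,
      ← pow_mul, ← pow_add 2 i (u - i), Nat.add_sub_cancel' (by omega), pow_two_pow_eq_neg_one hζ]
    ring
  obtain ⟨d', hyd', hd'⟩ := exists_coords_of_fixed d hyd (hdV.trans hVM) _ (by omega) hfix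
  rw [← hωdef, show u - (u + 1 - (t + 3)) = t + 2 by omega] at hyd'
  rw [show u - (u + 1 - (t + 3)) = t + 2 by omega] at hd'
  have hodd := odd_part_of_negated (γ : F →+* F) hγω d' (2 ^ (t + 2)) (by
    rw [← hyd']
    exact hγy)
  rw [← hyd'] at hodd
  have hres := two_pow_mul_add_mem (m := m) (n := n) hωneg
    (coeff_eq_zero_of_sum_pow_eq_zero hω) ((charRing G).comap ι) (τ : F →+* F) (α : F →+* F)
    (hmapω τ 5 hτ) (fun z hz => map_mem_comap_charRing hζ ι hN τ hz) ha4 (hmapω α a hα) hε hαωε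
    (by
      have := hn
      rw [← hωdef, ← hmapω α a hα] at this
      exact this)
    (y := y) (by
      rw [Subring.mem_comap, hy]
      exact Subring.subset_closure ⟨V, hV, g, rfl⟩)
    (by
      rintro rfl
      rw [map_zero] at hy
      exact hV0 hy.symm)
    hαy _ hodd (fun i hi => if_neg (Nat.not_odd_iff_even.mpr hi))
    (le_trans (Finset.sum_le_sum fun i _ => by split_ifs <;> simp) hd')
  exact ⟨hres.1, hres.2 i hi⟩

end TwoGroups

section Classification

variable {G : Type} [Group G] {u : ℕ} {F : Type} [Field F] [NumberField F] {ζ : F}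
  [IsCyclotomicExtension {2 ^ (u + 1)} ℚ F]

theorem exists_coords_of_fixed_conjExponents (hζ : IsPrimitiveRoot ζ (2 ^ (u + 1))) {g : G}
    {k : ℕ} (hk : 2 ≤ k) (hku : k ≤ u + 1) (hk1 : ∀ b, b % 2 ^ k = 1 → b ∈ conjExponents g) {z : F}
    (hz : ∀ (σ : F ≃ₐ[ℚ] F) (b : ℕ), σ ζ = ζ ^ b → IsConj g (g ^ b) → σ z = z) (c : ℕ → ℤ)
    (hc : z = ∑ i ∈ Finset.range (2 ^ u), (c i : F) * ζ ^ i) :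
    ∃ d : ℕ → ℤ, z = ∑ i ∈ Finset.range (2 ^ (k - 1)),
      (d i : F) * (ζ ^ 2 ^ (u + 1 - k)) ^ i := by
  obtain ⟨d, hd, -⟩ := exists_coords_of_fixed c hc le_rfl (u + 1 - k) (by omega) fun i hi => by
    obtain ⟨q, hq⟩ := pow_dvd_pow 2 (show k ≤ u - i by omega)
    obtain ⟨σ, hσ⟩ := exists_algEquiv_pow hζ (b := 1 + 2 ^ (u - i)) (by
      rw [show u - i = (u - i - 1) + 1 by omega, pow_succ', Nat.odd_iff]
      omega)
    refine ⟨σ, ?_, hz σ _ hσ (hk1 _ ?_)⟩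
    · change σ (ζ ^ 2 ^ i) = _
      rw [map_pow, hσ, pow_right_comm, pow_add, pow_one, ← pow_mul, ← pow_add 2 i (u - i),
        Nat.add_sub_cancel' (by omega), pow_two_pow_eq_neg_one hζ]
      ring
    · rw [hq, Nat.add_mul_mod_self_left, Nat.mod_eq_of_lt]
      exact Nat.one_lt_pow (by omega) (by norm_num)
  rw [show u - (u + 1 - k) = k - 1 by omega] at hd
  exact ⟨d, hd⟩

theorem charFieldAt_eq_cycField_two_pow [Finite G] (hζ : IsPrimitiveRoot ζ (2 ^ (u + 1)))
    (ι : F →+* ℂ) (hN : Nat.card G ∣ 2 ^ (u + 1)) {g : G} {k : ℕ} (hk : 2 ≤ k) (hku : k ≤ u + 1)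
    (hk1 : ∀ b, b % 2 ^ k = 1 → b ∈ conjExponents g)
    (hk2 : ∀ b ∈ conjExponents g, b % 4 = 1 → b % 2 ^ k = 1)
    (hk3 : ∀ b ∈ conjExponents g, b % 4 ≠ 3) : charFieldAt g = cycField (2 ^ k) := by
  have hω : IsPrimitiveRoot (ζ ^ 2 ^ (u + 1 - k)) (2 ^ k) := by
    refine hζ.pow (by positivity) ?_
    rw [← pow_add]
    congr 1
    omega
  have hω' := hω.map_of_injective ι.injective
  apply le_antisymm
  · refine Subfield.closure_le.mpr ?_
    rintro _ ⟨V, hV, rfl⟩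
    obtain ⟨z, hz, hzσ, c, hc, -⟩ := exists_character_lift hζ ι hN V g
    obtain ⟨d, hd⟩ := exists_coords_of_fixed_conjExponents hζ hk hku hk1 (fun σ b hσ hb => by
      refine ι.injective ((hzσ (σ : F →+* F) b hσ).trans ?_)
      obtain ⟨t, ht⟩ := isConj_iff.mp hb
      rw [← ht, V.char_conj, hz]) c hc
    rw [← hz, hd, map_sum]
    refine sum_mem fun i _ => ?_
    rw [map_mul, map_intCast, map_pow]
    refine mul_mem (intCast_mem _ _) (pow_mem (Subfield.subset_closure ?_) _)
    exact hω'.pow_eq_one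
  · refine Subfield.closure_le.mpr ?_
    intro w hw
    obtain ⟨i, -, rfl⟩ := hω'.eq_pow_of_pow_eq_one hw
    refine pow_mem (mem_charFieldAt_of_fixed hζ ι hN g fun σ b hb hσ hbA => ?_) i
    have h1 : b % 2 ^ k = 1 := by
      refine hk2 b hbA ?_
      have := hk3 b hbA
      rw [Nat.odd_iff] at hb
      omega
    have h2 : b ≡ 1 [MOD 2 ^ k] := by
      rw [Nat.ModEq, h1, Nat.mod_eq_of_lt (Nat.one_lt_pow (by omega) (by norm_num))]
    rw [map_pow, hσ, pow_right_comm, pow_eq_pow_of_modEq h2 hω.pow_eq_one, pow_one]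

theorem charFieldAt_eq_cycField_one (hζ : IsPrimitiveRoot ζ (2 ^ (u + 1)))
    (ι : F →+* ℂ) (hN : Nat.card G ∣ 2 ^ (u + 1)) {g : G} (hu : 2 ≤ u + 1)
    (hk1 : ∀ b, b % 2 ^ 2 = 1 → b ∈ conjExponents g) {a : ℕ} (ha : a ∈ conjExponents g)
    (ha4 : a % 4 = 3) : charFieldAt g = cycField 1 := by
  have hω : IsPrimitiveRoot (ζ ^ 2 ^ (u + 1 - 2)) (2 ^ (1 + 1)) := by
    refine hζ.pow (by positivity) ?_
    rw [← pow_add]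
    congr 1
    omega
  obtain ⟨α, hα⟩ := exists_algEquiv_pow hζ (b := a) (Nat.odd_iff.mpr (by omega))
  apply le_antisymm
  · refine Subfield.closure_le.mpr ?_
    rintro _ ⟨V, hV, rfl⟩
    obtain ⟨z, hz, hzσ, c, hc, -⟩ := exists_character_lift hζ ι hN V g
    have hfix : ∀ (σ : F ≃ₐ[ℚ] F) (b : ℕ), σ ζ = ζ ^ b → IsConj g (g ^ b) → σ z = z := by
      intro σ b hσ hb
      refine ι.injective ((hzσ (σ : F →+* F) b hσ).trans ?_)
      obtain ⟨t, ht⟩ := isConj_iff.mp hb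
      rw [← ht, V.char_conj, hz]
    obtain ⟨d, hd⟩ := exists_coords_of_fixed_conjExponents hζ le_rfl hu hk1 hfix c hc
    have hαω : (α : F →+* F) (ζ ^ 2 ^ (u + 1 - 2)) = -ζ ^ 2 ^ (u + 1 - 2) := by
      change α _ = _
      have h3 : a ≡ 2 ^ 1 + 1 [MOD 2 ^ (1 + 1)] := ha4
      rw [map_pow, hα, pow_right_comm, pow_eq_pow_of_modEq h3 hω.pow_eq_one, pow_succ,
        pow_two_pow_eq_neg_one hω]
      ring
    have h0 := even_part_of_fixed (α : F →+* F) hαω d 1 (by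
      rw [show 2 * 1 = 2 ^ (2 - 1) by norm_num, ← hd]
      exact hfix α a hα ha)
    rw [show 2 * 1 = 2 ^ (2 - 1) by norm_num, ← hd] at h0
    rw [← hz, h0]
    simp
  · refine Subfield.closure_le.mpr ?_
    intro w hw
    rw [Set.mem_ofPred_eq, pow_one] at hw
    rw [hw]
    exact (charFieldAt g).one_mem

end Classification

/-- If `G` is a finite 2-group and `g ∈ G` is such that `K := ℚ(g)` is
not a cyclotomic field, then `M · ℤ_K ⊆ 2 · ℤ[G]`, where `M` is the largest degree of an
irreducible character of `G`. -/
theorem max_degree_mul_ringOfIntIn_subset_two_charRing (G : Type) [Group G] [Finite G]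
    (hG : IsPGroup 2 G) (g : G)
    (hnc : ¬ ∃ m : ℕ, 0 < m ∧ charFieldAt g = cycField m) :
    ∀ x ∈ ringOfIntIn (charFieldAt g), ∃ y ∈ charRing G,
      ((sSup {d : ℕ | ∃ V : FDRep ℂ G, Simple V ∧ finrank ℂ V = d} : ℕ) : ℂ) * x =
        2 * y := by
  have hset : {d : ℕ | ∃ V : FDRep ℂ G, Simple V ∧ finrank ℂ V = d} = degreeSet G := rfl
  rw [hset]
  obtain ⟨n, hn⟩ := (IsPGroup.iff_card (p := 2)).mp hG
  have hN : Nat.card G ∣ 2 ^ (n + 2 + 1) := by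
    rw [hn]
    exact pow_dvd_pow 2 (by omega)
  let F := CyclotomicField (2 ^ (n + 2 + 1)) ℚ
  have : NeZero ((2 ^ (n + 2 + 1) : ℕ) : ℚ) := ⟨by positivity⟩
  have : IsCyclotomicExtension {2 ^ (n + 2 + 1)} ℚ F :=
    CyclotomicField.isCyclotomicExtension (2 ^ (n + 2 + 1)) ℚ
  have hζ := IsCyclotomicExtension.zeta_spec (2 ^ (n + 2 + 1)) ℚ F
  set ζ : F := IsCyclotomicExtension.zeta (2 ^ (n + 2 + 1)) ℚ F
  obtain ⟨ι⟩ : Nonempty (F →+* ℂ) := inferInstance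
  have hg : g ^ 2 ^ (n + 2 + 1) = 1 := by
    obtain ⟨q, hq⟩ := hN
    rw [hq, pow_mul, pow_card_eq_one', one_pow]
  obtain ⟨k, hk, hku, hk1, hk2⟩ := exists_level (e := n + 2 + 1) (by omega) (conjExponents g)
    (one_mem_conjExponents g) (fun b hb c hc => mul_mem_conjExponents hb hc)
    (fun b hb c h => mem_conjExponents_of_modEq hg hb h)
  obtain ⟨a, ha, ha4⟩ : ∃ a ∈ conjExponents g, a % 4 = 3 := by
    by_contra! h
    exact hnc ⟨2 ^ k, by positivity, charFieldAt_eq_cycField_two_pow hζ ι hN hk hku hk1 hk2 h⟩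
  have hk3 : 3 ≤ k := by
    by_contra h
    obtain rfl : k = 2 := by omega
    exact hnc ⟨1, one_pos, charFieldAt_eq_cycField_one hζ ι hN hku hk1 ha ha4⟩
  obtain ⟨α, hα⟩ := exists_algEquiv_pow hζ (b := a) (Nat.odd_iff.mpr (by omega))
  obtain ⟨m, hm⟩ : ∃ m, sSup (degreeSet G) = 2 ^ m := by
    refine sSup_degreeSet_eq_two_pow hG ?_
    obtain ⟨V, hV, -⟩ := exists_character_eq_neg _ G rfl hG g (g ^ 5) (fun h => by
      have h5 := hk2 5 h (by norm_num)
      have h8 : 2 ^ 3 ≤ 2 ^ k := Nat.pow_le_pow_right (by norm_num) hk3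
      rw [Nat.mod_eq_of_lt (by omega)] at h5
      omega)
    exact ⟨_, V, hV, rfl⟩
  have key : ∀ t, t + 3 ≤ k → ∀ i, Odd i → _ := fun t ht i hi =>
    two_pow_mul_add_mem_charRing hG hζ ι hN hm hku hk1 hk2 ha ha4 α hα ht hi
  have hm1 : 1 ≤ m := (key 0 hk3 1 odd_one).1
  intro x hx
  obtain ⟨hxint, hxK⟩ := hx
  obtain ⟨z, rfl, hzσ⟩ := exists_charFieldAt_lift hζ ι hN g hxK
  have hz : IsIntegral ℤ z :=
    (isIntegral_algHom_iff ι.toIntAlgHom ι.injective).mp hxint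
  obtain ⟨c, hc⟩ := exists_coords_of_isIntegral hζ hz
  obtain ⟨d, hd⟩ := exists_coords_of_fixed_conjExponents hζ hk hku hk1 hzσ c hc
  set ω := ζ ^ 2 ^ (n + 2 + 1 - k) with hωdef
  obtain ⟨w, rfl⟩ : ∃ w, k = w + 3 := ⟨k - 3, by omega⟩
  have hω : IsPrimitiveRoot ω (2 ^ (w + 2 + 1)) := by
    refine hζ.pow (by positivity) ?_
    rw [← pow_add]
    congr 1
    omega
  have hαω : α ω = ω ^ a := by rw [hωdef, map_pow, hα, pow_right_comm]
  have hαω2 : (α ω * ω) ^ 2 = 1 := by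
    rw [hαω, ← pow_succ, ← pow_mul, mul_comm, hω.pow_eq_one_iff_dvd]
    exact two_pow_dvd_two_mul_succ ha4
      (hk2 _ (mul_mem_conjExponents ha ha) (by rw [Nat.mul_mod, ha4]))
  obtain ⟨ε, hε, hαωε⟩ : ∃ ε : ℤ, (ε = 1 ∨ ε = -1) ∧ α ω * ω = ε := by
    rcases eq_or_eq_neg_of_sq_eq_sq (α ω * ω) 1 (by rw [hαω2, one_pow]) with h | h
    · exact ⟨1, Or.inl rfl, by rw [h]; simp⟩
    · exact ⟨-1, Or.inr rfl, by rw [h]; simp⟩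
  have hpow : 2 ^ (w + 3 - 1) = 2 * 2 ^ (w + 1) := by
    rw [← pow_succ']
    rfl
  have hpow' : 2 * 2 ^ (w + 1) = 2 ^ (w + 2) := by ring
  rw [hpow] at hd
  have hfix := (coords_of_fixed (h := 2 ^ (w + 1)) (by positivity)
    (by rw [pow_succ]; exact even_two.mul_left _)
    (by rw [hpow']; exact pow_two_pow_eq_neg_one hω)
    (by rw [hpow']; exact coeff_eq_zero_of_sum_pow_eq_zero hω) (α : F →+* F) hε hαωε d
    (by rw [← hd]; exact hzσ α a hα ha)).2
  rw [← hd] at hfix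
  refine ⟨ι (2 ^ (m - 1) * z), ?_, ?_⟩
  · change 2 ^ (m - 1) * z ∈ (charRing G).comap ι
    rw [hfix, mul_add, Finset.mul_sum]
    refine add_mem (mul_mem (pow_mem (ofNat_mem _ 2) _) (intCast_mem _ _))
      (sum_mem fun i hi => ?_)
    rw [mul_left_comm]
    refine mul_mem (intCast_mem _ _) ?_
    rw [Finset.mem_Ico] at hi
    obtain ⟨v, q, hq, rfl⟩ := Nat.exists_eq_two_pow_mul_odd (n := i) (by omega)
    have hv : v < w + 1 := by
      refine (Nat.pow_lt_pow_iff_right (a := 2) (by norm_num)).mp (lt_of_le_of_lt ?_ hi.2)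
      exact Nat.le_mul_of_pos_right _ hq.pos
    have h1 := (key (w - v) (by omega) q hq).2
    have h2 : (ζ ^ 2 ^ (n + 2 + 1 - (w - v + 3))) = ω ^ 2 ^ v := by
      rw [hωdef, ← pow_mul, ← pow_add]
      congr 2
      omega
    rw [h2, ← pow_mul] at h1
    exact h1
  · rw [hm, map_mul, map_pow, map_ofNat, ← mul_assoc, ← pow_succ', Nat.sub_add_cancel hm1]
    push_cast
    rfl
end

section
/- For every prime p and every integer n ≥ 1 there exists a finite group P of order p^{2n+2} and exponent p^2 such that ℚ(P) is the p^2-th cyclotomic field ℚ(ζ_{p^2}) and the quotient ℤ_{ℚ(P)}/ℤ[P] is isomorphic to the direct product of (p−1)^2 copies of the cyclic group ℤ/p^nℤ. -/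
open CategoryTheory Module Pointwise
open scoped MatrixGroups

/-- The conclusion of Statement 12 for a group `P`: `P` has order `p^(2n+2)`, exponent
`p^2`, `ℚ(P) = ℚ(ζ_{p^2})`, and `ℤ_{ℚ(P)}/ℤ[P] ≅ (ℤ/p^nℤ)^((p-1)^2)`. -/
def IsExtraspecialLikeExample (p n : ℕ) (P : Type) [Group P] : Prop :=
  Nat.card P = p ^ (2 * n + 2) ∧ Monoid.exponent P = p ^ 2 ∧
  charField P = cycField (p ^ 2) ∧
  Nonempty (charQuot P ≃+ (Fin ((p - 1) ^ 2) → ZMod (p ^ n)))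

section Cyclotomic

variable {p : ℕ} {ζ : ℂ}

/-- The field `ℚ(ζ_m)` is generated over `ℚ` by one primitive root of unity. -/
theorem cycField_eq_adjoin {m : ℕ} [NeZero m] (hζ : IsPrimitiveRoot ζ m) :
    cycField m = (IntermediateField.adjoin ℚ {ζ}).toSubfield := by
  apply le_antisymm
  · refine Subfield.closure_le.2 fun z hz => ?_
    obtain ⟨i, -, rfl⟩ := hζ.eq_pow_of_pow_eq_one hz
    exact pow_mem (IntermediateField.mem_adjoin_simple_self ℚ ζ) i
  · let L : IntermediateField ℚ ℂ :=
      (cycField m).toIntermediateField fun x => by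
        rw [eq_ratCast]; exact SubfieldClass.ratCast_mem _ x
    have h : IntermediateField.adjoin ℚ {ζ} ≤ L := by
      rw [IntermediateField.adjoin_le_iff, Set.singleton_subset_iff]
      exact Subfield.subset_closure hζ.pow_eq_one
    exact fun x hx => h hx

/-- The ring of integers of `ℚ(ζ_{p^k})` is `ℤ[ζ_{p^k}]`. -/
theorem ringOfIntIn_cycField [Fact p.Prime] {k : ℕ} (hζ : IsPrimitiveRoot ζ (p ^ k)) :
    ringOfIntIn (cycField (p ^ k)) = (Algebra.adjoin ℤ {ζ}).toSubring := by
  have : NeZero (p ^ k) := ⟨pow_ne_zero _ (Fact.out : p.Prime).ne_zero⟩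
  rw [cycField_eq_adjoin hζ]
  set L := IntermediateField.adjoin ℚ {ζ}
  have hζL : IsPrimitiveRoot (IntermediateField.AdjoinSimple.gen ℚ ζ) (p ^ k) :=
    IsPrimitiveRoot.coe_submonoidClass_iff.mp hζ
  have hcyc : IsCyclotomicExtension {p ^ k} ℚ L :=
    (IntermediateField.isCyclotomicExtension_singleton_iff_eq_adjoin (p ^ k) ℚ ℂ L hζ).2 rfl
  have hic := IsCyclotomicExtension.Rat.isIntegralClosure_adjoin_singleton_of_prime_pow hζL
  ext x
  constructor
  · rintro ⟨hx, hxL⟩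
    have hxL' : x ∈ L := hxL
    have hx' : IsIntegral ℤ (⟨x, hxL'⟩ : L) :=
      (isIntegral_algebraMap_iff (B := ℂ) (algebraMap L ℂ).injective).1 hx
    obtain ⟨y, hy⟩ := hic.isIntegral_iff.1 hx'
    have hmap : (L.val.restrictScalars ℤ) (y : L) ∈ Algebra.adjoin ℤ {ζ} := by
      have := Subalgebra.mem_map.2 ⟨(y : L), y.2, (rfl : L.val.restrictScalars ℤ y = _)⟩
      rwa [AlgHom.map_adjoin, Set.image_singleton] at this
    have hyx : (y : L) = ⟨x, hxL'⟩ := hy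
    rw [hyx] at hmap
    exact hmap
  · intro hx
    refine ⟨?_, ?_⟩
    · exact (Algebra.adjoin_le (S := integralClosure ℤ ℂ) (Set.singleton_subset_iff.2
        (hζ.isIntegral (NeZero.pos _)))) hx
    · exact (Algebra.adjoin_le (S := L.toSubalgebra.restrictScalars ℤ) (Set.singleton_subset_iff.2
        (IntermediateField.mem_adjoin_simple_self ℚ ζ))) hx

/-- The power basis `1, ζ, ζ², …` of `ℤ[ζ]`, for a primitive `p²`-th root of unity `ζ`. -/
noncomputable def cycPowerBasis (hp : p.Prime) (hζ : IsPrimitiveRoot ζ (p ^ 2)) :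
    PowerBasis ℤ (Algebra.adjoin ℤ {ζ}) :=
  Algebra.adjoin.powerBasis' (hζ.isIntegral (pow_pos hp.pos 2))

theorem cycPowerBasis_dim (hp : p.Prime) (hζ : IsPrimitiveRoot ζ (p ^ 2)) :
    (cycPowerBasis hp hζ).dim = p * (p - 1) := by
  rw [cycPowerBasis, Algebra.adjoin.powerBasis'_dim,
    ← Polynomial.cyclotomic_eq_minpoly hζ (pow_pos hp.pos 2), Polynomial.natDegree_cyclotomic,
    Nat.totient_prime_pow hp two_pos]
  simp

theorem coe_cycPowerBasis_basis (hp : p.Prime) (hζ : IsPrimitiveRoot ζ (p ^ 2))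
    (k : Fin (cycPowerBasis hp hζ).dim) :
    ((cycPowerBasis hp hζ).basis k : ℂ) = ζ ^ (k : ℕ) := by
  have hgen : ((cycPowerBasis hp hζ).gen : ℂ) = ζ :=
    congrArg Subtype.val (Algebra.adjoin.powerBasis'_gen (hζ.isIntegral (pow_pos hp.pos 2)))
  rw [PowerBasis.basis_eq_pow, SubmonoidClass.coe_pow, hgen]

theorem cycPowerBasis_coord_pow_mul (hp : p.Prime) (hζ : IsPrimitiveRoot ζ (p ^ 2))
    {k : Fin (cycPowerBasis hp hζ).dim} (hk : ¬ p ∣ (k : ℕ)) (y : Algebra.adjoin ℤ {ζ}) (m : ℕ)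
    (hy : (y : ℂ) = ζ ^ (p * m)) : (cycPowerBasis hp hζ).basis.coord k y = 0 := by
  have small : ∀ j < p - 1, ∀ z : Algebra.adjoin ℤ {ζ}, (z : ℂ) = ζ ^ (p * j) →
      (cycPowerBasis hp hζ).basis.coord k z = 0 := by
    intro j hj z hz
    have hj' : p * j < (cycPowerBasis hp hζ).dim := by
      rw [cycPowerBasis_dim]; exact Nat.mul_lt_mul_of_pos_left hj hp.pos
    have hzb : z = (cycPowerBasis hp hζ).basis ⟨p * j, hj'⟩ :=
      Subtype.ext (by rw [hz, coe_cycPowerBasis_basis])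
    rw [hzb, Basis.coord_apply, Basis.repr_self, Finsupp.single_eq_of_ne]
    rintro rfl
    exact hk (dvd_mul_right _ _)
  have hζp : IsPrimitiveRoot (ζ ^ p) p := hζ.pow (pow_pos hp.pos 2) (sq p)
  rw [pow_mul, ← Nat.div_add_mod m p, pow_add, pow_mul, hζp.pow_eq_one, one_pow, one_mul,
    ← pow_mul] at hy
  have hlt := Nat.mod_lt m hp.pos
  rcases lt_or_ge (m % p) (p - 1) with h | h
  · exact small _ h y hy
  · have hm : m % p = p - 1 := by omega
    let b : Algebra.adjoin ℤ {ζ} := ⟨ζ, Algebra.self_mem_adjoin_singleton ℤ ζ⟩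
    have hsum : y = -∑ j ∈ Finset.range (p - 1), b ^ (p * j) := by
      apply Subtype.ext
      have h0 := hζp.geom_sum_eq_zero hp.one_lt
      rw [← Nat.sub_add_cancel hp.one_le, Finset.sum_range_succ, Nat.sub_add_cancel hp.one_le] at h0
      rw [hy, hm, pow_mul]
      push_cast
      simp only [b, pow_mul]
      linear_combination h0
    rw [hsum, map_neg, map_sum, neg_eq_zero]
    exact Finset.sum_eq_zero fun j hj => small j (Finset.mem_range.1 hj) _ (by simp [b])

/-- The subring `ℤ[ζ^p] + q ℤ[ζ]` of `ℂ`. -/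
def adjoinPowAddMul (ζ : ℂ) (p : ℕ) (q : ℤ) : Subring ℂ where
  carrier := {x | ∃ a ∈ Algebra.adjoin ℤ {ζ ^ p}, ∃ b ∈ Algebra.adjoin ℤ {ζ}, x = a + q * b}
  mul_mem' := by
    rintro _ _ ⟨a, ha, b, hb, rfl⟩ ⟨a', ha', b', hb', rfl⟩
    have hle : Algebra.adjoin ℤ {ζ ^ p} ≤ Algebra.adjoin ℤ {ζ} :=
      Algebra.adjoin_le (Set.singleton_subset_iff.2
        (pow_mem (Algebra.self_mem_adjoin_singleton ℤ ζ) p))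
    refine ⟨a * a', mul_mem ha ha', a * b' + b * a' + q * b * b', ?_, by ring⟩
    exact add_mem (add_mem (mul_mem (hle ha) hb') (mul_mem hb (hle ha')))
      (mul_mem (mul_mem (intCast_mem _ q) hb) hb')
  one_mem' := ⟨1, one_mem _, 0, zero_mem _, by simp⟩
  add_mem' := by
    rintro _ _ ⟨a, ha, b, hb, rfl⟩ ⟨a', ha', b', hb', rfl⟩
    exact ⟨a + a', add_mem ha ha', b + b', add_mem hb hb', by ring⟩
  zero_mem' := ⟨0, zero_mem _, 0, zero_mem _, by simp⟩
  neg_mem' := by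
    rintro _ ⟨a, ha, b, hb, rfl⟩
    exact ⟨-a, neg_mem ha, -b, neg_mem hb, by ring⟩

theorem dvd_coord_of_mem_adjoinPowAddMul (hp : p.Prime) (hζ : IsPrimitiveRoot ζ (p ^ 2)) {q : ℤ}
    (x : Algebra.adjoin ℤ {ζ}) (hx : (x : ℂ) ∈ adjoinPowAddMul ζ p q)
    {k : Fin (cycPowerBasis hp hζ).dim} (hk : ¬ p ∣ (k : ℕ)) :
    q ∣ (cycPowerBasis hp hζ).basis.coord k x := by
  obtain ⟨a, ha, b, hb, hab⟩ := hx
  rw [Algebra.adjoin_singleton_eq_range_aeval] at ha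
  obtain ⟨f, rfl⟩ := ha
  let z : Algebra.adjoin ℤ {ζ} := ⟨ζ, Algebra.self_mem_adjoin_singleton ℤ ζ⟩
  have hxz : x = Polynomial.aeval (z ^ p) f + q • ⟨b, hb⟩ := by
    apply Subtype.ext
    rw [hab]
    have : ((Polynomial.aeval (z ^ p) f : Algebra.adjoin ℤ {ζ}) : ℂ) =
        Polynomial.aeval (ζ ^ p) f :=
      (Polynomial.aeval_algHom_apply (Algebra.adjoin ℤ {ζ}).val (z ^ p) f).symm
    simp [this]
  have h0 : (cycPowerBasis hp hζ).basis.coord k (Polynomial.aeval (z ^ p) f) = 0 := by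
    rw [Polynomial.aeval_eq_sum_range, map_sum]
    refine Finset.sum_eq_zero fun m _ => ?_
    rw [map_smul, cycPowerBasis_coord_pow_mul hp hζ hk _ m (by simp [z, pow_mul]), smul_zero]
  rw [hxz, map_add, h0, zero_add, map_smul, smul_eq_mul]
  exact dvd_mul_right _ _

theorem mem_of_dvd_coord (hp : p.Prime) (hζ : IsPrimitiveRoot ζ (p ^ 2)) {q : ℤ} {S : Subring ℂ}
    (hS : ζ ^ p ∈ S) (hqS : ∀ k : ℕ, q * ζ ^ k ∈ S) (x : Algebra.adjoin ℤ {ζ})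
    (hx : ∀ k : Fin (cycPowerBasis hp hζ).dim, ¬ p ∣ (k : ℕ) →
      q ∣ (cycPowerBasis hp hζ).basis.coord k x) : (x : ℂ) ∈ S := by
  rw [← (cycPowerBasis hp hζ).basis.sum_repr x]
  push_cast
  refine sum_mem fun k _ => ?_
  rw [coe_cycPowerBasis_basis]
  by_cases hk : p ∣ (k : ℕ)
  · obtain ⟨j, hj⟩ := hk
    rw [hj, pow_mul]
    exact zsmul_mem (pow_mem hS j) _
  · obtain ⟨d, hd⟩ := hx k hk
    rw [Basis.coord_apply] at hd
    rw [hd, zsmul_eq_mul, Int.cast_mul, mul_comm (q : ℂ), mul_assoc]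
    exact mul_mem (intCast_mem S d) (hqS k)

theorem card_not_dvd (hp : p.Prime) :
    Nat.card {k : Fin (p * (p - 1)) // ¬ p ∣ (k : ℕ)} = (p - 1) ^ 2 := by
  have hcount : Nat.card {k : Fin (p * (p - 1)) // p ∣ (k : ℕ)} = p - 1 := by
    have h := Nat.count_modEq_card (p * (p - 1)) hp.pos 0
    rw [Nat.mul_div_cancel_left _ hp.pos, Nat.zero_mod, Nat.mul_mod_right, if_neg (lt_irrefl _),
      add_zero] at h
    simp only [Nat.modEq_zero_iff_dvd] at h
    rw [Nat.card_eq_fintype_card, Fintype.card_subtype, Finset.card_filter]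
    refine Eq.trans ?_ h
    rw [Nat.count_eq_card_filter_range, Finset.card_filter,
      Finset.sum_range fun i => if p ∣ i then 1 else 0]
  have h := Fintype.card_subtype_compl fun k : Fin (p * (p - 1)) => p ∣ (k : ℕ)
  rw [Nat.card_eq_fintype_card] at hcount
  rw [Nat.card_eq_fintype_card, h, hcount, Fintype.card_fin, ← Nat.sub_one_mul, sq]

/-- If `ℤ[G]` is `ℤ[ζ^p] + q ℤ[ζ]` inside `ℤ_{ℚ(G)} = ℤ[ζ]`, then the quotient is
`(ℤ/q)^((p-1)^2)`. -/
theorem nonempty_charQuot_addEquiv (hp : p.Prime) (hζ : IsPrimitiveRoot ζ (p ^ 2)) {q : ℕ}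
    {G : Type} [Group G] (hfield : charField G = cycField (p ^ 2))
    (hle : charRing G ≤ adjoinPowAddMul ζ p q) (hζp : ζ ^ p ∈ charRing G)
    (hq : ∀ k : ℕ, q * ζ ^ k ∈ charRing G) :
    Nonempty (charQuot G ≃+ (Fin ((p - 1) ^ 2) → ZMod q)) := by
  have : Fact p.Prime := ⟨hp⟩
  have hring : ringOfIntIn (charField G) = (Algebra.adjoin ℤ {ζ}).toSubring := by
    rw [hfield, ringOfIntIn_cycField hζ]
  have hmem (x : (ringOfIntIn (charField G)).toAddSubgroup) :
      (x : ℂ) ∈ Algebra.adjoin ℤ {ζ} :=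
    (SetLike.ext_iff.1 hring (x : ℂ)).1 x.2
  set B := (cycPowerBasis hp hζ).basis
  have e : Fin ((p - 1) ^ 2) ≃ {k : Fin (cycPowerBasis hp hζ).dim // ¬ p ∣ (k : ℕ)} := by
    refine (Finite.equivFinOfCardEq ?_).symm
    rw [cycPowerBasis_dim, card_not_dvd hp]
  let f : (ringOfIntIn (charField G)).toAddSubgroup →+ (Fin ((p - 1) ^ 2) → ZMod q) :=
    { toFun := fun x i => ((B.coord (e i) ⟨x, hmem x⟩ : ℤ) : ZMod q)
      map_zero' := by
        ext i
        have : (⟨((0 : (ringOfIntIn (charField G)).toAddSubgroup) : ℂ), hmem 0⟩ :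
          Algebra.adjoin ℤ {ζ}) = 0 := rfl
        simp only [this, map_zero, Int.cast_zero, Pi.zero_apply]
      map_add' := fun x y => by
        ext i
        have : (⟨((x + y : (ringOfIntIn (charField G)).toAddSubgroup) : ℂ), hmem _⟩ :
          Algebra.adjoin ℤ {ζ}) = ⟨x, hmem x⟩ + ⟨y, hmem y⟩ := rfl
        simp only [this, map_add, Int.cast_add, Pi.add_apply] }
  have hker : f.ker = (charRing G).toAddSubgroup.addSubgroupOf
      (ringOfIntIn (charField G)).toAddSubgroup := by
    ext x
    rw [AddMonoidHom.mem_ker, AddSubgroup.mem_addSubgroupOf, funext_iff]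
    have hf (i) : f x i = 0 ↔ (q : ℤ) ∣ B.coord (e i) ⟨x, hmem x⟩ :=
      ZMod.intCast_zmod_eq_zero_iff_dvd _ q
    constructor
    · intro h
      refine mem_of_dvd_coord hp hζ (q := q) (S := charRing G) hζp (by simpa using hq)
        ⟨x, hmem x⟩ fun k hk => ?_
      have := (hf (e.symm ⟨k, hk⟩)).1 (h _)
      rwa [e.apply_symm_apply] at this
    · intro h i
      exact (hf i).2 (dvd_coord_of_mem_adjoinPowAddMul hp hζ ⟨x, hmem x⟩ (hle h) (e i).2)
  have hsurj : Function.Surjective f := by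
    intro v
    choose w hw using fun i => ZMod.intCast_surjective (v i)
    let y : Algebra.adjoin ℤ {ζ} := ∑ i, w i • B (e i)
    have hy : (y : ℂ) ∈ ringOfIntIn (charField G) := by rw [hring]; exact y.2
    refine ⟨⟨y, hy⟩, funext fun i => ?_⟩
    have : B.coord (e i) y = w i := by
      rw [map_sum, Finset.sum_eq_single i]
      · rw [map_smul, Basis.coord_apply, Basis.repr_self, Finsupp.single_eq_same, smul_eq_mul,
          mul_one]
      · intro j _ hj
        rw [map_smul, Basis.coord_apply, Basis.repr_self, Finsupp.single_eq_of_ne, smul_zero]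
        exact fun h => hj (e.injective (Subtype.ext h.symm))
      · exact fun h => absurd (Finset.mem_univ i) h
    exact (congrArg (Int.cast : ℤ → ZMod q) this).trans (hw i)
  exact ⟨(QuotientAddGroup.quotientAddEquivOfEq hker.symm).trans
    (QuotientAddGroup.quotientKerEquivOfSurjective f hsurj)⟩

end Cyclotomic

section Schur

variable {G : Type} [Group G]

/-- Schur's lemma for linear maps commuting with a simple representation. -/
theorem FDRep.exists_eq_smul_of_commute (V : FDRep ℂ G) [Simple V] {f : V →ₗ[ℂ] V}
    (hf : ∀ g, Commute (V.ρ g) f) : ∃ c : ℂ, f = c • 1 := by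
  have mem {φ : V →ₗ[ℂ] V} (hφ : ∀ g, Commute (V.ρ g) φ) :
      φ ∈ (Representation.linHom V.ρ V.ρ).invariants := fun g => by
    rw [Representation.linHom_apply, ← LinearMap.comp_assoc, ← Module.End.mul_eq_comp,
      ← Module.End.mul_eq_comp, (hφ g).eq, mul_assoc, ← map_mul, mul_inv_cancel, map_one, mul_one]
  have hfin : finrank ℂ (Representation.linHom V.ρ V.ρ).invariants = 1 := by
    rw [(Representation.linHom.invariantsEquivFDRepHom V V).finrank_eq]
    exact finrank_endomorphism_simple_eq_one ℂ V
  by_cases h1 : (1 : V →ₗ[ℂ] V) = 0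
  · exact ⟨0, by rw [← mul_one f, h1, mul_zero, smul_zero]⟩
  · obtain ⟨c, hc⟩ := (finrank_eq_one_iff_of_nonzero' (⟨1, mem fun g => Commute.one_right _⟩ :
      (Representation.linHom V.ρ V.ρ).invariants) fun h => h1 (congrArg Subtype.val h)).1 hfin
      ⟨f, mem hf⟩
    exact ⟨c, (congrArg Subtype.val hc).symm⟩

theorem FDRep.character_eq_of_eq_smul (V : FDRep ℂ G) {g : G} {c : ℂ} (h : V.ρ g = c • 1) :
    V.character g = c * finrank ℂ V := by
  rw [FDRep.character, h, map_smul, LinearMap.trace_one, smul_eq_mul]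

theorem FDRep.character_mul_character_inv_of_eq_smul (V : FDRep ℂ G) {g : G} {c c' : ℂ}
    (h : V.ρ g = c • 1) (h' : V.ρ g⁻¹ = c' • 1) :
    V.character g * V.character g⁻¹ = (finrank ℂ V : ℂ) ^ 2 := by
  have h1 : V.ρ 1 = (c * c') • 1 := by
    rw [← mul_inv_cancel g, map_mul, h, h', smul_mul_smul_comm, one_mul]
  have h2 := V.character_eq_of_eq_smul h1
  rw [FDRep.char_one] at h2
  rw [V.character_eq_of_eq_smul h, V.character_eq_of_eq_smul h']
  linear_combination -(finrank ℂ V : ℂ) * h2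

theorem FDRep.finrank_ne_zero [Finite G] (V : FDRep ℂ G) [hV : Simple V] : finrank ℂ V ≠ 0 := by
  have := Fintype.ofFinite G
  intro h
  have hz (g : G) : V.character g = 0 := by
    have := finrank_zero_iff.1 h
    rw [FDRep.character, Subsingleton.elim (V.ρ g) 0, map_zero]
  have h1 := (FDRep.simple_iff_char_is_norm_one V).1 hV
  simp only [hz, mul_zero, Finset.sum_const_zero] at h1
  exact (Nat.card_pos (α := G)).ne (by exact_mod_cast h1)

theorem FDRep.eq_one_of_smul_one_eq [Finite G] (V : FDRep ℂ G) [Simple V] {c : ℂ}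
    (h : (c • 1 : V →ₗ[ℂ] V) = 1) : c = 1 := by
  have h1 : V.ρ 1 = c • 1 := by rw [h, map_one]
  have h2 := V.character_eq_of_eq_smul h1
  rw [FDRep.char_one] at h2
  exact (mul_eq_right₀ (Nat.cast_ne_zero.2 V.finrank_ne_zero)).1 h2.symm

theorem FDRep.finrank_eq_one_of_forall_eq_smul [Finite G] (V : FDRep ℂ G) [hV : Simple V]
    {c : G → ℂ} (h : ∀ g, V.ρ g = c g • 1) : finrank ℂ V = 1 := by
  have := Fintype.ofFinite G
  have h1 := (FDRep.simple_iff_char_is_norm_one V).1 hV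
  simp only [V.character_mul_character_inv_of_eq_smul (h _) (h _), Finset.sum_const,
    Finset.card_univ, nsmul_eq_mul, Fintype.card_eq_nat_card] at h1
  have h2 := (mul_eq_left₀ (Nat.cast_ne_zero.2 Nat.card_pos.ne')).1 h1
  have h3 : finrank ℂ V ^ 2 = 1 := by exact_mod_cast h2
  exact (Nat.pow_eq_one.1 h3).resolve_right two_ne_zero

/-- The values of a linear character are character values. -/
theorem MonoidHom.apply_mem_charValues [Finite G] (χ : G →* ℂ) (g : G) : χ g ∈ charValues G := by
  have := Fintype.ofFinite G
  let V : FDRep ℂ G := FDRep.of ((Algebra.lmul ℂ ℂ : ℂ →* (ℂ →ₗ[ℂ] ℂ)).comp χ)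
  have hV (g : G) : V.ρ g = χ g • 1 := by
    refine LinearMap.ext fun x => ?_
    rfl
  have hfin : finrank ℂ V = 1 := finrank_self ℂ
  refine ⟨V, (FDRep.simple_iff_char_is_norm_one V).2 ?_, g, ?_⟩
  · simp only [V.character_mul_character_inv_of_eq_smul (hV _) (hV _), hfin]
    simp
  · rw [V.character_eq_of_eq_smul (hV g), hfin, Nat.cast_one, mul_one]

end Schur

/-- The Heisenberg group of `(ZMod p)^n`, with centre enlarged along `ψ : ZMod p → Z`. -/
@[ext]
structure HeisenbergGroup {p : ℕ} {Z : Type} [CommGroup Z] (n : ℕ) (ψ : AddChar (ZMod p) Z) where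
  /-- The position coordinate. -/
  a : Fin n → ZMod p
  /-- The momentum coordinate. -/
  b : Fin n → ZMod p
  /-- The central coordinate. -/
  z : Z

namespace HeisenbergGroup

open Matrix

variable {p n : ℕ} {Z : Type} [CommGroup Z] {ψ : AddChar (ZMod p) Z}

instance : Group (HeisenbergGroup n ψ) where
  mul g h := ⟨g.a + h.a, g.b + h.b, g.z * h.z * ψ (g.a ⬝ᵥ h.b)⟩
  one := ⟨0, 0, 1⟩
  inv g := ⟨-g.a, -g.b, g.z⁻¹ * ψ (g.a ⬝ᵥ g.b)⟩
  mul_assoc g h k := by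
    refine HeisenbergGroup.ext (add_assoc _ _ _) (add_assoc _ _ _) ?_
    change g.z * h.z * ψ (g.a ⬝ᵥ h.b) * k.z * ψ ((g.a + h.a) ⬝ᵥ k.b) =
      g.z * (h.z * k.z * ψ (h.a ⬝ᵥ k.b)) * ψ (g.a ⬝ᵥ (h.b + k.b))
    rw [add_dotProduct, dotProduct_add, AddChar.map_add_eq_mul, AddChar.map_add_eq_mul]
    simp only [mul_assoc, mul_comm, mul_left_comm]
  one_mul g := by
    refine HeisenbergGroup.ext (zero_add _) (zero_add _) ?_
    change 1 * g.z * ψ (0 ⬝ᵥ g.b) = g.z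
    simp
  mul_one g := by
    refine HeisenbergGroup.ext (add_zero _) (add_zero _) ?_
    change g.z * 1 * ψ (g.a ⬝ᵥ 0) = g.z
    simp
  inv_mul_cancel g := by
    refine HeisenbergGroup.ext (neg_add_cancel _) (neg_add_cancel _) ?_
    change g.z⁻¹ * ψ (g.a ⬝ᵥ g.b) * g.z * ψ (-g.a ⬝ᵥ g.b) = 1
    rw [neg_dotProduct, mul_right_comm _ (ψ _), inv_mul_cancel, one_mul,
      ← AddChar.map_add_eq_mul, add_neg_cancel, AddChar.map_zero_eq_one]

@[simp] theorem mul_a (g h : HeisenbergGroup n ψ) : (g * h).a = g.a + h.a := rfl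
@[simp] theorem mul_b (g h : HeisenbergGroup n ψ) : (g * h).b = g.b + h.b := rfl
@[simp] theorem mul_z (g h : HeisenbergGroup n ψ) :
    (g * h).z = g.z * h.z * ψ (g.a ⬝ᵥ h.b) := rfl
@[simp] theorem one_a : (1 : HeisenbergGroup n ψ).a = 0 := rfl
@[simp] theorem one_b : (1 : HeisenbergGroup n ψ).b = 0 := rfl
@[simp] theorem one_z : (1 : HeisenbergGroup n ψ).z = 1 := rfl

variable (n ψ) in
/-- The inclusion of the centre. -/
def central : Z →* HeisenbergGroup n ψ where
  toFun z := ⟨0, 0, z⟩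
  map_one' := rfl
  map_mul' z w := by ext <;> simp

@[simp] theorem central_a (z : Z) : (central n ψ z).a = 0 := rfl
@[simp] theorem central_b (z : Z) : (central n ψ z).b = 0 := rfl
@[simp] theorem central_z (z : Z) : (central n ψ z).z = z := rfl

theorem central_mul_comm (z : Z) (g : HeisenbergGroup n ψ) :
    central n ψ z * g = g * central n ψ z := by
  ext <;> simp [mul_comm]

theorem eq_central {g : HeisenbergGroup n ψ} (ha : g.a = 0) (hb : g.b = 0) :
    g = central n ψ g.z := by
  ext <;> simp [ha, hb]

theorem mul_eq_central_mul (g h : HeisenbergGroup n ψ) :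
    g * h = central n ψ (ψ (g.a ⬝ᵥ h.b - h.a ⬝ᵥ g.b)) * (h * g) := by
  ext
  · simp [add_comm]
  · simp [add_comm]
  · have : ψ (g.a ⬝ᵥ h.b - h.a ⬝ᵥ g.b) * ψ (h.a ⬝ᵥ g.b) = ψ (g.a ⬝ᵥ h.b) := by
      rw [← AddChar.map_add_eq_mul, sub_add_cancel]
    simp only [mul_z, central_z, central_a, zero_dotProduct, AddChar.map_zero_eq_one, mul_one]
    rw [← this, mul_comm g.z h.z, mul_left_comm]

theorem exists_mul_eq_central_mul [Fact p.Prime] {g : HeisenbergGroup n ψ}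
    (hg : ¬ (g.a = 0 ∧ g.b = 0)) : ∃ h, g * h = central n ψ (ψ 1) * (h * g) := by
  suffices ∃ h : HeisenbergGroup n ψ, g.a ⬝ᵥ h.b - h.a ⬝ᵥ g.b = 1 by
    obtain ⟨h, hh⟩ := this
    exact ⟨h, hh ▸ mul_eq_central_mul g h⟩
  by_cases ha : g.a = 0
  · obtain ⟨i, hi⟩ := Function.ne_iff.1 fun hb => hg ⟨ha, hb⟩
    exact ⟨⟨Pi.single i (-(g.b i)⁻¹), 0, 1⟩, by simpa using inv_mul_cancel₀ hi⟩
  · obtain ⟨i, hi⟩ := Function.ne_iff.1 ha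
    exact ⟨⟨0, Pi.single i (g.a i)⁻¹, 1⟩, by simpa using mul_inv_cancel₀ hi⟩

theorem exists_pow_eq (g : HeisenbergGroup n ψ) (k : ℕ) :
    ∃ m, g ^ k = ⟨k • g.a, k • g.b, g.z ^ k * ψ m⟩ := by
  induction k with
  | zero => exact ⟨0, by ext <;> simp⟩
  | succ k ih =>
    obtain ⟨m, hm⟩ := ih
    refine ⟨m + (k • g.a) ⬝ᵥ g.b, ?_⟩
    rw [pow_succ, hm]
    ext
    · simp [add_mul]
    · simp [add_mul]
    · simp only [mul_z, AddChar.map_add_eq_mul, pow_succ]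
      rw [mul_right_comm (g.z ^ k), mul_assoc (g.z ^ k * g.z)]

theorem exists_pow_prime_eq_central (g : HeisenbergGroup n ψ) :
    ∃ m, g ^ p = central n ψ (g.z ^ p * ψ m) := by
  obtain ⟨m, hm⟩ := exists_pow_eq g p
  have h (v : Fin n → ZMod p) : p • v = 0 := by ext; simp
  exact ⟨m, by rw [hm, h, h]; rfl⟩

variable (n ψ) in
/-- The underlying set of the Heisenberg group is a product. -/
def equivProd : HeisenbergGroup n ψ ≃ ((Fin n → ZMod p) × (Fin n → ZMod p)) × Z where
  toFun g := ((g.a, g.b), g.z)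
  invFun x := ⟨x.1.1, x.1.2, x.2⟩
  left_inv _ := rfl
  right_inv _ := rfl

theorem card_eq : Nat.card (HeisenbergGroup n ψ) = p ^ (2 * n) * Nat.card Z := by
  rw [Nat.card_congr (equivProd n ψ), Nat.card_prod, Nat.card_prod, Nat.card_fun, Nat.card_zmod,
    Nat.card_fin, ← pow_add, two_mul]

instance [NeZero p] [Finite Z] : Finite (HeisenbergGroup n ψ) :=
  Finite.of_equiv _ (equivProd n ψ).symm

end HeisenbergGroup

namespace HeisenbergGroup

open Matrix

variable {p n : ℕ} {Z : Type} [CommGroup Z] {ψ : AddChar (ZMod p) Z}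

theorem character_eq_zero [Fact p.Prime] (V : FDRep ℂ (HeisenbergGroup n ψ)) {μ : ℂ} (hμ : μ ≠ 1)
    (hV : V.ρ (central n ψ (ψ 1)) = μ • 1) {g : HeisenbergGroup n ψ}
    (hg : ¬ (g.a = 0 ∧ g.b = 0)) : V.character g = 0 := by
  obtain ⟨h, hh⟩ := exists_mul_eq_central_mul hg
  have h1 : V.character (h⁻¹ * (g * h)) = V.character g := by
    simpa [mul_assoc] using V.char_conj g h⁻¹
  rw [hh, central_mul_comm, mul_assoc, inv_mul_cancel_left] at h1
  rw [← central_mul_comm, FDRep.character, map_mul, hV, smul_one_mul, map_smul, smul_eq_mul] at h1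
  have h2 : (μ - 1) * V.character g = 0 := by
    rw [sub_mul, one_mul, sub_eq_zero]; exact h1
  exact (mul_eq_zero.1 h2).resolve_left (sub_ne_zero.2 hμ)

theorem sum_character_mul_character_inv [Fact p.Prime] [Finite Z]
    [Fintype (HeisenbergGroup n ψ)] (V : FDRep ℂ (HeisenbergGroup n ψ)) {μ : Z → ℂ}
    (hμ : μ (ψ 1) ≠ 1) (hV : ∀ z, V.ρ (central n ψ z) = μ z • 1) :
    ∑ g, V.character g * V.character g⁻¹ = Nat.card Z * (finrank ℂ V : ℂ) ^ 2 := by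
  have := Fintype.ofFinite Z
  rw [← (equivProd n ψ).symm.sum_comp, Fintype.sum_prod_type, Finset.sum_eq_single 0]
  · have (z : Z) : (equivProd n ψ).symm (0, z) = central n ψ z := rfl
    simp only [this]
    rw [Finset.sum_congr rfl fun z _ => V.character_mul_character_inv_of_eq_smul (hV z)
      (c' := μ z⁻¹) (by rw [← map_inv, hV])]
    simp
  · intro x _ hx
    refine Finset.sum_eq_zero fun z _ => ?_
    rw [character_eq_zero V hμ (hV _), zero_mul]
    exact fun h => hx (Prod.ext h.1 h.2)
  · simp

/-- The Schrödinger representation of the Heisenberg group with central character `e`. -/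
def schrodinger (n : ℕ) (ψ : AddChar (ZMod p) Z) (e : Z →* ℂ) :
    HeisenbergGroup n ψ →* (((Fin n → ZMod p) → ℂ) →ₗ[ℂ] ((Fin n → ZMod p) → ℂ)) where
  toFun g :=
    { toFun := fun f x => e g.z * e (ψ (x ⬝ᵥ g.b)) * f (x + g.a)
      map_add' := fun f f' => funext fun x => mul_add _ _ _
      map_smul' := fun c f => funext fun x => mul_left_comm _ _ _ }
  map_one' := by
    refine LinearMap.ext fun f => funext fun x => ?_
    simp
  map_mul' g h := by
    refine LinearMap.ext fun f => funext fun x => ?_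
    simp only [mul_a, mul_b, mul_z, map_mul, dotProduct_add, add_dotProduct,
      AddChar.map_add_eq_mul, LinearMap.coe_mk, AddHom.coe_mk, Module.End.mul_apply, add_assoc]
    ring

theorem natCast_pow_mul_mem_charValues [Fact p.Prime] [Finite Z] (e : Z →* ℂ) (he : e (ψ 1) ≠ 1)
    (z : Z) : (p : ℂ) ^ n * e z ∈ charValues (HeisenbergGroup n ψ) := by
  have := Fintype.ofFinite (HeisenbergGroup n ψ)
  let V : FDRep ℂ (HeisenbergGroup n ψ) := FDRep.of (schrodinger n ψ e)
  have hV (z : Z) : V.ρ (central n ψ z) = e z • 1 := by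
    refine LinearMap.ext fun f => funext fun x => ?_
    change e z * e (ψ (x ⬝ᵥ 0)) * f (x + 0) = e z * f x
    simp
  have hfin : finrank ℂ V = p ^ n := by
    change finrank ℂ ((Fin n → ZMod p) → ℂ) = p ^ n
    simp
  refine ⟨V, (FDRep.simple_iff_char_is_norm_one V).2 ?_, central n ψ z, ?_⟩
  · rw [sum_character_mul_character_inv V he hV, hfin, card_eq]
    push_cast
    ring
  · rw [V.character_eq_of_eq_smul (hV z), hfin, mul_comm]
    push_cast
    ring

theorem character_pow_eq_one [Fact p.Prime] [Finite Z] (hZ : ∀ z : Z, (z ^ p) ^ p = 1)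
    (hψ : ∀ z : Z, z ^ p = 1 → ∃ m, ψ m = z) (V : FDRep ℂ (HeisenbergGroup n ψ)) [Simple V]
    (hV : V.ρ (central n ψ (ψ 1)) = 1) (g : HeisenbergGroup n ψ) : V.character g ^ p = 1 := by
  have hψV (m : ZMod p) : V.ρ (central n ψ (ψ m)) = 1 := by
    rw [← ZMod.natCast_zmod_val m, ← nsmul_one, AddChar.map_nsmul_eq_pow, map_pow, map_pow, hV,
      one_pow]
  have hcomm (g h : HeisenbergGroup n ψ) : Commute (V.ρ g) (V.ρ h) := by
    rw [Commute, SemiconjBy, ← map_mul, mul_eq_central_mul, map_mul, hψV, one_mul, map_mul]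
  choose c hc using fun g => V.exists_eq_smul_of_commute fun h => hcomm h g
  have hfin := V.finrank_eq_one_of_forall_eq_smul hc
  rw [V.character_eq_of_eq_smul (hc g), hfin, Nat.cast_one, mul_one]
  refine V.eq_one_of_smul_one_eq ?_
  have h1 : V.ρ (g ^ p) = 1 := by
    obtain ⟨m, hm⟩ := exists_pow_prime_eq_central g
    obtain ⟨m', hm'⟩ := hψ _ (hZ g.z)
    rw [hm, ← hm', ← AddChar.map_add_eq_mul, hψV]
  rwa [map_pow, hc g, smul_pow, one_pow] at h1

theorem character_eq_zero_or [Fact p.Prime] [Finite Z] (hZ : ∀ z : Z, (z ^ p) ^ p = 1)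
    (V : FDRep ℂ (HeisenbergGroup n ψ)) [hs : Simple V]
    (hV : V.ρ (central n ψ (ψ 1)) ≠ 1) (g : HeisenbergGroup n ψ) :
    V.character g = 0 ∨ ∃ w : ℂ, w ^ p ^ 2 = 1 ∧ V.character g = p ^ n * w := by
  have := Fintype.ofFinite (HeisenbergGroup n ψ)
  choose μ hμ using fun z => V.exists_eq_smul_of_commute (f := V.ρ (central n ψ z)) fun h => by
    rw [Commute, SemiconjBy, ← map_mul, ← map_mul, central_mul_comm]
  have hμ1 : μ (ψ 1) ≠ 1 := fun h => hV (by rw [hμ, h, one_smul])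
  by_cases hg : g.a = 0 ∧ g.b = 0
  · refine Or.inr ⟨μ g.z, ?_, ?_⟩
    · refine V.eq_one_of_smul_one_eq ?_
      have h1 : V.ρ (central n ψ (g.z ^ p ^ 2)) = 1 := by
        rw [sq, pow_mul, hZ, map_one, map_one]
      rwa [map_pow, map_pow, hμ, smul_pow, one_pow] at h1
    · have hsum := (FDRep.simple_iff_char_is_norm_one V).1 hs
      rw [sum_character_mul_character_inv V hμ1 hμ, card_eq, mul_comm] at hsum
      have h2 : finrank ℂ V ^ 2 * Nat.card Z = p ^ (2 * n) * Nat.card Z := by exact_mod_cast hsum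
      have h3 : finrank ℂ V ^ 2 = (p ^ n) ^ 2 := by
        rw [Nat.eq_of_mul_eq_mul_right Nat.card_pos h2, ← pow_mul, mul_comm n]
      have h4 : finrank ℂ V = p ^ n := Nat.pow_left_injective two_ne_zero h3
      conv_lhs => rw [eq_central hg.1 hg.2, V.character_eq_of_eq_smul (hμ g.z), h4]
      push_cast
      ring
  · exact Or.inl (character_eq_zero V hμ1 (hμ _) hg)

/-- The linear character `g ↦ e (g.z ^ p)`. -/
def powCharacter (hψ : ∀ m, ψ m ^ p = 1) (e : Z →* ℂ) : HeisenbergGroup n ψ →* ℂ where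
  toFun g := e (g.z ^ p)
  map_one' := by simp
  map_mul' g h := by simp [mul_pow, hψ]

theorem exponent_eq [Fact p.Prime] (hZ : Monoid.exponent Z = p ^ 2) (hψ : ∀ m, ψ m ^ p = 1) :
    Monoid.exponent (HeisenbergGroup n ψ) = p ^ 2 := by
  apply Nat.dvd_antisymm
  · refine Monoid.exponent_dvd_of_forall_pow_eq_one fun g => ?_
    obtain ⟨m, hm⟩ := exists_pow_prime_eq_central g
    rw [sq, pow_mul, hm, ← map_pow, mul_pow, hψ, ← pow_mul, ← sq, ← hZ, Monoid.pow_exponent_eq_one,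
      mul_one, map_one]
  · rw [← hZ]
    exact Monoid.exponent_dvd_of_monoidHom (central n ψ) fun z w h => congrArg HeisenbergGroup.z h

end HeisenbergGroup

/-- For every prime `p` and `n ≥ 1` there is a group `P` of order
`p^(2n+2)` and exponent `p^2` with `ℚ(P) = ℚ(ζ_{p^2})` and
`ℤ_{ℚ(P)}/ℤ[P] ≅ C_{p^n}^((p-1)^2)`. -/
theorem exists_group_charQuot_iso (p n : ℕ) (hp : p.Prime) (hn : 1 ≤ n) :
    ∃ (P : Type) (inst : Group P), Finite P ∧ @IsExtraspecialLikeExample p n P inst := by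
  have : Fact p.Prime := ⟨hp⟩
  have hζ := Complex.isPrimitiveRoot_exp (p ^ 2) (pow_ne_zero 2 hp.ne_zero)
  set ζ := Complex.exp (2 * Real.pi * Complex.I / (p ^ 2 : ℕ))
  have hζp : IsPrimitiveRoot (ζ ^ p) p := hζ.pow (pow_pos hp.pos 2) (sq p)
  have : NeZero (p ^ 2) := ⟨pow_ne_zero 2 hp.ne_zero⟩
  let Z := rootsOfUnity (p ^ 2) ℂ
  let u : Z := hζ.toRootsOfUnity
  let e : Z →* ℂ := (Units.coeHom ℂ).comp (rootsOfUnity (p ^ 2) ℂ).subtype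
  have he : Function.Injective e := Units.val_injective.comp Subtype.val_injective
  have heu : e u = ζ := rfl
  have hu : IsPrimitiveRoot u (p ^ 2) := IsPrimitiveRoot.of_map_of_injective hζ he
  have hup : (u ^ p) ^ p = 1 := by rw [← pow_mul, ← sq, hu.pow_eq_one]
  have hZ (z : Z) : z ^ p ^ 2 = 1 := Subtype.ext z.2
  have hZ' (z : Z) : (z ^ p) ^ p = 1 := by rw [← pow_mul, ← sq, hZ]
  have hexp : Monoid.exponent Z = p ^ 2 :=
    Nat.dvd_antisymm (Monoid.exponent_dvd_of_forall_pow_eq_one hZ)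
      (hu.dvd_of_pow_eq_one _ (Monoid.pow_exponent_eq_one u))
  have hcard : Nat.card Z = p ^ 2 := hζ.card_rootsOfUnity
  let ψ : AddChar (ZMod p) Z := AddChar.zmodChar p hup
  have hψ1 : ψ 1 = u ^ p := by
    rw [← Nat.cast_one, AddChar.zmodChar_apply', pow_one]
  have hψp (m : ZMod p) : ψ m ^ p = 1 := by
    rw [AddChar.zmodChar_apply, ← pow_mul, mul_comm, pow_mul, hup, one_pow]
  have hψ (z : Z) (hz : z ^ p = 1) : ∃ m, ψ m = z := by
    obtain ⟨i, -, hi⟩ := hζp.eq_pow_of_pow_eq_one (ξ := e z) (by rw [← map_pow, hz, map_one])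
    exact ⟨i, he (by rw [AddChar.zmodChar_apply', map_pow, map_pow, heu, hi])⟩
  have heψ : e (ψ 1) ≠ 1 := by
    rw [hψ1, map_pow, heu]
    exact hζp.ne_one hp.one_lt
  let P := HeisenbergGroup n ψ
  have hroot : ζ ^ p ∈ charValues P :=
    (HeisenbergGroup.powCharacter hψp e).apply_mem_charValues (HeisenbergGroup.central n ψ u)
  have hmul (k : ℕ) : (p : ℂ) ^ n * ζ ^ k ∈ charValues P := by
    have h := HeisenbergGroup.natCast_pow_mul_mem_charValues (n := n) e heψ (u ^ k)
    rwa [map_pow, heu] at h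
  have hval {x : ℂ} (hx : x ∈ charValues P) :
      (∃ k : ℕ, x = (ζ ^ p) ^ k) ∨ x = 0 ∨ ∃ k : ℕ, x = p ^ n * ζ ^ k := by
    obtain ⟨V, hV, g, rfl⟩ := hx
    by_cases h : V.ρ (HeisenbergGroup.central n ψ (ψ 1)) = 1
    · obtain ⟨k, -, hk⟩ := hζp.eq_pow_of_pow_eq_one
        (HeisenbergGroup.character_pow_eq_one hZ' hψ V h g)
      exact Or.inl ⟨k, hk.symm⟩
    · obtain h | ⟨w, hw, h⟩ := HeisenbergGroup.character_eq_zero_or hZ' V h g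
      · exact Or.inr (Or.inl h)
      · obtain ⟨k, -, rfl⟩ := hζ.eq_pow_of_pow_eq_one hw
        exact Or.inr (Or.inr ⟨k, h⟩)
  have hfield : charField P = cycField (p ^ 2) := by
    have hζmem : ζ ∈ cycField (p ^ 2) := Subfield.subset_closure hζ.pow_eq_one
    refine le_antisymm (Subfield.closure_le.2 fun x hx => ?_) (Subfield.closure_le.2 fun x hx => ?_)
    · obtain ⟨k, rfl⟩ | rfl | ⟨k, rfl⟩ := hval hx
      · exact pow_mem (pow_mem hζmem p) k
      · exact zero_mem _
      · exact mul_mem (pow_mem (natCast_mem _ p) n) (pow_mem hζmem k)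
    · obtain ⟨k, -, rfl⟩ := hζ.eq_pow_of_pow_eq_one hx
      rw [← mul_div_cancel_left₀ (ζ ^ k) (pow_ne_zero n (Nat.cast_ne_zero.2 hp.ne_zero))]
      exact div_mem (Subfield.subset_closure (hmul k)) (pow_mem (natCast_mem _ p) n)
  refine ⟨P, inferInstance, inferInstance, ?_, HeisenbergGroup.exponent_eq hexp hψp, hfield,
    nonempty_charQuot_addEquiv hp hζ hfield ?_ (Subring.subset_closure hroot) fun k => ?_⟩
  · rw [HeisenbergGroup.card_eq, hcard, pow_add]
  · refine Subring.closure_le.2 fun x hx => ?_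
    obtain ⟨k, rfl⟩ | rfl | ⟨k, rfl⟩ := hval hx
    · exact ⟨_, pow_mem (Algebra.self_mem_adjoin_singleton ℤ _) k, 0, zero_mem _, by simp⟩
    · exact zero_mem _
    · exact ⟨0, zero_mem _, _, pow_mem (Algebra.self_mem_adjoin_singleton ℤ ζ) k, by simp⟩
  · rw [Nat.cast_pow]
    exact Subring.subset_closure (hmul k)
end

section
/- Let G be a finite abelian group. Then ℚ(G) = ℚ(ζ_{exp(G)}), the exp(G)-th cyclotomic field, and ℤ[G] = ℤ_{ℚ(G)}, i.e. the subring generated by the character values of G equals the full ring of integers of ℚ(G). -/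
open CategoryTheory Module Pointwise
open scoped MatrixGroups

/-- A group element acts on a representation of an abelian group by an endomorphism of
that representation. -/
noncomputable def FDRep.actionEnd {k G : Type} [Field k] [CommGroup G] (V : FDRep k G) (g : G) :
    V ⟶ V where
  hom := Action.ρ V g
  comm h := by
    change Action.ρ V g * Action.ρ V h = Action.ρ V h * Action.ρ V g
    rw [← map_mul, ← map_mul, mul_comm]

/-- Elements of an abelian group act by scalars on a simple representation. -/
lemma FDRep.exists_ρ_eq_smul_one {G : Type} [CommGroup G] (V : FDRep ℂ G) [Simple V]
    (g : G) : ∃ c : ℂ, V.ρ g = c • (1 : V →ₗ[ℂ] V) := by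
  obtain ⟨c, hc⟩ := (finrank_eq_one_iff_of_nonzero' (𝟙 V) (id_nonzero V)).mp
    (finrank_endomorphism_simple_eq_one ℂ V) (V.actionEnd g)
  refine ⟨c, ?_⟩
  have h := congrArg (fun f : V ⟶ V => f.hom.hom.hom) hc
  exact h.symm

lemma FDRep.finrank_eq_one_of_simple {G : Type} [CommGroup G] [Finite G] (V : FDRep ℂ G)
    [Simple V] : finrank ℂ V = 1 := by
  have := Fintype.ofFinite G
  have hnorm := (FDRep.simple_iff_char_is_norm_one V).mp inferInstance
  have hterm (g : G) : V.character g * V.character g⁻¹ = (finrank ℂ V : ℂ) ^ 2 := by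
    obtain ⟨c, hc⟩ := V.exists_ρ_eq_smul_one g
    obtain ⟨d, hd⟩ := V.exists_ρ_eq_smul_one g⁻¹
    have hcd : (c * d) • (1 : V →ₗ[ℂ] V) = 1 := by
      rw [← mul_one (1 : V →ₗ[ℂ] V), ← smul_mul_smul_comm, ← hc, ← hd, ← map_mul,
        mul_inv_cancel, map_one, mul_one]
    have htr := congrArg (LinearMap.trace ℂ V) hcd
    rw [map_smul, LinearMap.trace_one, smul_eq_mul] at htr
    simp only [FDRep.character, hc, hd, map_smul, LinearMap.trace_one, smul_eq_mul]
    linear_combination (finrank ℂ V : ℂ) * htr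
  have hcard : (Nat.card G : ℂ) ≠ 0 := Nat.cast_ne_zero.mpr Nat.card_pos.ne'
  simp only [hterm, Finset.sum_const, Finset.card_univ, nsmul_eq_mul,
    ← Nat.card_eq_fintype_card] at hnorm
  have hsq : (finrank ℂ V : ℂ) ^ 2 = 1 := mul_left_cancel₀ hcard (by rw [hnorm, mul_one])
  exact (Nat.pow_eq_one.mp (by exact_mod_cast hsq)).resolve_right two_ne_zero

/-- The character values of simple representations of a finite abelian group are roots of unity
of order dividing the exponent. -/
lemma FDRep.character_pow_exponent {G : Type} [CommGroup G] [Finite G] (V : FDRep ℂ G)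
    [Simple V] (g : G) : V.character g ^ Monoid.exponent G = 1 := by
  obtain ⟨c, hc⟩ := V.exists_ρ_eq_smul_one g
  have hdim := V.finrank_eq_one_of_simple
  have hchar : V.character g = c := by
    simp [FDRep.character, hc, LinearMap.trace_one, hdim]
  have hpow : c ^ Monoid.exponent G • (1 : V →ₗ[ℂ] V) = 1 := by
    rw [← one_pow (M := V →ₗ[ℂ] V) (Monoid.exponent G), ← smul_pow, ← hc, ← map_pow,
      Monoid.pow_exponent_eq_one, map_one, one_pow]
  have htr := congrArg (LinearMap.trace ℂ V) hpow
  rw [map_smul, LinearMap.trace_one, hdim] at htr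
  simpa [hchar] using htr

/-- The one-dimensional representation attached to a linear character. -/
noncomputable def FDRep.ofLinearChar {G : Type} [Group G] (φ : G →* ℂˣ) : FDRep ℂ G :=
  FDRep.of (V := ℂ) ((algebraMap ℂ (Module.End ℂ ℂ)).toMonoidHom.comp
    ((Units.coeHom ℂ).comp φ))

lemma FDRep.character_ofLinearChar {G : Type} [Group G] (φ : G →* ℂˣ) (g : G) :
    (FDRep.ofLinearChar φ).character g = φ g := by
  change LinearMap.trace ℂ ℂ (algebraMap ℂ (Module.End ℂ ℂ) (φ g)) = φ g
  rw [Algebra.algebraMap_eq_smul_one, map_smul, LinearMap.trace_one]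
  simp

lemma FDRep.simple_ofLinearChar {G : Type} [Group G] [Finite G] (φ : G →* ℂˣ) :
    Simple (FDRep.ofLinearChar φ) := by
  have := Fintype.ofFinite G
  rw [FDRep.simple_iff_char_is_norm_one]
  simp [FDRep.character_ofLinearChar]

/-- Every root of unity of order dividing the exponent of a finite abelian group is a value of a
linear character. -/
lemma CommGroup.exists_monoidHom_apply_eq {G : Type} [CommGroup G] [Finite G] {z : ℂˣ}
    (hz : z ^ Monoid.exponent G = 1) : ∃ (φ : G →* ℂˣ) (g : G), φ g = z := by
  obtain ⟨g, hg⟩ := Monoid.exists_orderOf_eq_exponent (Monoid.ExponentExists.of_finite (G := G))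
  have hord : orderOf z ∣ orderOf (⟨g, Subgroup.mem_zpowers g⟩ : Subgroup.zpowers g) := by
    rw [Subgroup.orderOf_mk, hg]
    exact orderOf_dvd_of_pow_eq_one hz
  have hgen (x : Subgroup.zpowers g) :
      x ∈ Subgroup.zpowers (⟨g, Subgroup.mem_zpowers g⟩ : Subgroup.zpowers g) := by
    obtain ⟨x, n, rfl⟩ := x
    exact ⟨n, rfl⟩
  have : NeZero (Monoid.exponent G) := ⟨Monoid.exponent_ne_zero_of_finite⟩
  obtain ⟨φ, hφ⟩ := MonoidHom.domRestrict_surjective ℂ (Subgroup.zpowers g)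
    (monoidHomOfForallMemZpowers hgen hord)
  refine ⟨φ, g, ?_⟩
  have h := DFunLike.congr_fun hφ ⟨g, Subgroup.mem_zpowers g⟩
  rwa [monoidHomOfForallMemZpowers_apply_gen] at h

/-- The character values of a finite abelian group are the roots of unity of order dividing its
exponent. -/
lemma charValues_eq_of_comm (G : Type) [CommGroup G] [Finite G] :
    charValues G = {z : ℂ | z ^ Monoid.exponent G = 1} := by
  ext z
  constructor
  · rintro ⟨V, hV, g, rfl⟩
    exact V.character_pow_exponent g
  · intro hz
    have hne : Monoid.exponent G ≠ 0 := Monoid.exponent_ne_zero_of_finite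
    obtain ⟨φ, g, hφ⟩ := CommGroup.exists_monoidHom_apply_eq (G := G)
      (z := Units.ofPowEqOne z _ hz hne) (Units.pow_ofPowEqOne hz hne)
    refine ⟨FDRep.ofLinearChar φ, FDRep.simple_ofLinearChar φ, g, ?_⟩
    rw [FDRep.character_ofLinearChar, hφ]
    rfl

/-- The ring of integers of `ℚ(ζ_n)` is generated by the `n`-th roots of unity. -/
lemma ringOfIntIn_cycField_s14 (n : ℕ) [NeZero n] :
    ringOfIntIn (cycField n) = Subring.closure {z : ℂ | z ^ n = 1} := by
  apply le_antisymm
  · rintro x ⟨hint, hx⟩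
    have hζ := Complex.isPrimitiveRoot_exp n (NeZero.ne n)
    set ζ := Complex.exp (2 * Real.pi * Complex.I / n)
    let F := IntermediateField.adjoin ℚ {ζ}
    have hF : IsCyclotomicExtension {n} ℚ F := by
      change IsCyclotomicExtension {n} ℚ F.toSubalgebra
      rw [IntermediateField.adjoin_simple_toSubalgebra_of_isAlgebraic
        (hζ.isIntegral (NeZero.pos n)).tower_top.isAlgebraic]
      exact hζ.adjoin_isCyclotomicExtension ℚ
    have hζF : ζ ∈ F := IntermediateField.mem_adjoin_simple_self ℚ ζ
    have hle : cycField n ≤ F.toSubfield := by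
      refine Subfield.closure_le.mpr fun z hz => ?_
      obtain ⟨i, -, rfl⟩ := hζ.eq_pow_of_pow_eq_one hz
      exact pow_mem hζF i
    have hprim : IsPrimitiveRoot (⟨ζ, hζF⟩ : F) n :=
      IsPrimitiveRoot.coe_submonoidClass_iff.mp hζ
    have hintF : IsIntegral ℤ (⟨x, hle hx⟩ : F) :=
      (isIntegral_algHom_iff (F.val.restrictScalars ℤ) F.val.injective).mp hint
    obtain ⟨y, hy⟩ :=
      (IsCyclotomicExtension.Rat.isIntegralClosure_adjoin_singleton hprim).isIntegral_iff.mp hintF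
    have hmem : (F.val.restrictScalars ℤ) ⟨x, hle hx⟩ ∈
        (Algebra.adjoin ℤ {(⟨ζ, hζF⟩ : F)}).map (F.val.restrictScalars ℤ) :=
      ⟨_, hy ▸ y.2, rfl⟩
    rw [AlgHom.map_adjoin_singleton] at hmem
    have hsub : Algebra.adjoin ℤ {ζ} ≤ subalgebraOfSubring (Subring.closure {z : ℂ | z ^ n = 1}) :=
      Algebra.adjoin_le (Set.singleton_subset_iff.mpr (Subring.subset_closure hζ.pow_eq_one))
    exact hsub hmem
  · refine Subring.closure_le.mpr fun z hz => ⟨?_, Subfield.subset_closure hz⟩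
    exact IsIntegral.of_pow (NeZero.pos n) (by rw [hz]; exact isIntegral_one)

/-- For a finite abelian group `G`, `ℚ(G) = ℚ(ζ_{exp G})` and
`ℤ[G] = ℤ_{ℚ(G)}`. -/
theorem charField_eq_cycField_of_comm (G : Type) [CommGroup G] [Finite G] :
    charField G = cycField (Monoid.exponent G) ∧
    charRing G = ringOfIntIn (charField G) := by
  have hfield : charField G = cycField (Monoid.exponent G) := by
    rw [charField, charValues_eq_of_comm, cycField]
  have : NeZero (Monoid.exponent G) := ⟨Monoid.exponent_ne_zero_of_finite⟩
  exact ⟨hfield, by rw [hfield, ringOfIntIn_cycField_s14, charRing, charValues_eq_of_comm]⟩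
end
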